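/- arXiv:2102.10093 — 3 statements merged into one kernel-verified Lean document; each statement's English description precedes it below -/
import Mathlib

section
/- Let μ be a Borel probability measure on {1,2}^ℕ that is shift-invariant and ergodic, with μ([12121212]) > 0. Then for μ-almost every sequence (i_n) ∈ {1,2}^ℕ the associated C-adic language is balanced: there exists a constant C > 0 such that for every n ∈ ℕ, every letter a ∈ {1,2,3}, and all finite words u, v of equal length that both occur as factors of the word c_{i_0}∘c_{i_1}∘⋯∘c_{i_{n−1}}(1), one has | |u|_a − |v|_a | ≤ C, where |u|_a denotes the number of occurrences of the letter a in u. -/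
open Matrix Filter MeasureTheory

noncomputable section

/-- The substitution `c1 : 1 ↦ 1, 2 ↦ 13, 3 ↦ 2` (letters `1,2,3` encoded as `0,1,2 : Fin 3`). -/
def c1 : Fin 3 → List (Fin 3) := ![[0], [0, 2], [1]]

/-- The substitution `c2 : 1 ↦ 2, 2 ↦ 13, 3 ↦ 3`. -/
def c2 : Fin 3 → List (Fin 3) := ![[1], [0, 2], [2]]

/-- The substitution indexed by an element of `{1,2}` (encoded as `Fin 2`). -/
def cSub : Fin 2 → (Fin 3 → List (Fin 3)) := ![c1, c2]

/-- Application of a substitution to a word. -/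
def subApply (σ : Fin 3 → List (Fin 3)) (w : List (Fin 3)) : List (Fin 3) :=
  w.flatMap σ

/-- `dirProd σ n a` is the word `σ 0 ∘ σ 1 ∘ ... ∘ σ (n-1) (a)`. -/
def dirProd (σ : ℕ → (Fin 3 → List (Fin 3))) : ℕ → Fin 3 → List (Fin 3)
  | 0 => fun a => [a]
  | n + 1 => fun a => subApply (dirProd σ n) (σ n a)

/-- The shift map on sequences over `{1,2}` (encoded as `Fin 2`, letter `1` being `0`). -/
def shift : (ℕ → Fin 2) → (ℕ → Fin 2) := fun γ n => γ (n + 1)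

/-- The cylinder `[12121212]` of sequences starting with `1,2,1,2,1,2,1,2`. -/
def cyl8 : Set (ℕ → Fin 2) :=
  {γ | ∀ k < 8, γ k = if k % 2 = 0 then 0 else 1}

open scoped NNReal ENNReal

/-! ### Summability of the multiplicative visit weights of an ergodic map -/

/-- The sum, over the first `n` times `k`, of the products of the values of `c` along the first
`k` points of the orbit of `x` under `T`. -/
def weightSum {α : Type*} (T : α → α) (c : α → ℝ≥0) (n : ℕ) (x : α) : ℝ≥0 :=
  ∑ k ∈ Finset.range n, ∏ j ∈ Finset.range k, c (T^[j] x)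

lemma weightSum_succ {α : Type*} (T : α → α) (c : α → ℝ≥0) (n : ℕ) (x : α) :
    weightSum T c (n + 1) x = 1 + c x * weightSum T c n (T x) := by
  simp only [weightSum, Finset.sum_range_succ' _ n, Finset.prod_range_succ', Finset.mul_sum,
    Function.iterate_succ_apply, Function.iterate_zero_apply, Finset.prod_range_zero]
  rw [add_comm]
  congr 1
  exact Finset.sum_congr rfl fun _ _ => mul_comm _ _

lemma weightSum_mono {α : Type*} (T : α → α) (c : α → ℝ≥0) (x : α) :
    Monotone fun n => weightSum T c n x := fun _ _ h =>
  Finset.sum_le_sum_of_subset (Finset.range_mono h)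

lemma weightSum_le {α : Type*} (T : α → α) (c : α → ℝ≥0) (hc : ∀ x, c x ≤ 1) (n : ℕ) (x : α) :
    weightSum T c n x ≤ n := by
  refine (Finset.sum_le_card_nsmul _ _ 1 fun k _ => ?_).trans (by simp)
  exact Finset.prod_le_one (fun _ _ => zero_le) fun _ _ => hc _

lemma measurable_weightSum {α : Type*} [MeasurableSpace α] {T : α → α} (hT : Measurable T)
    {c : α → ℝ≥0} (hc : Measurable c) (n : ℕ) : Measurable (weightSum T c n) :=
  Finset.measurable_fun_sum _ fun _ _ => Finset.measurable_fun_prod _ fun j _ =>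
    hc.comp (hT.iterate j)

/-- The integral of the weight sums over the set of visits is bounded uniformly in `n`. -/
lemma setLIntegral_weightSum_le {α : Type*} [MeasurableSpace α] {μ : Measure α}
    [IsProbabilityMeasure μ] {T : α → α} (hT : MeasurePreserving T μ μ) {A : Set α}
    (hA : MeasurableSet A) {c : α → ℝ≥0} (hcm : Measurable c) {θ : ℝ≥0} (hθ : θ ≤ 1)
    (hcA : ∀ x ∈ A, c x = θ) (hc : ∀ x ∉ A, c x = 1) (n : ℕ) :
    ((1 - θ : ℝ≥0) : ℝ≥0∞) * ∫⁻ x in A, weightSum T c n (T x) ∂μ ≤ 1 := by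
  have hm := measurable_weightSum hT.measurable hcm
  have hc1 : ∀ x, c x ≤ 1 := fun x => by
    by_cases hx : x ∈ A
    · rw [hcA x hx]; exact hθ
    · rw [hc x hx]
  have hmT : Measurable fun x => (weightSum T c n (T x) : ℝ≥0∞) :=
    ((hm n).comp hT.measurable).coe_nnreal_ennreal
  have hcomp : ∫⁻ x, (weightSum T c n (T x) : ℝ≥0∞) ∂μ = ∫⁻ x, (weightSum T c n x : ℝ≥0∞) ∂μ :=
    hT.lintegral_comp (hm n).coe_nnreal_ennreal
  have hfin : ∫⁻ x, (weightSum T c (n + 1) x : ℝ≥0∞) ∂μ ≠ ∞ := by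
    refine ne_top_of_le_ne_top (b := ((n + 1 : ℕ) : ℝ≥0∞)) (ENNReal.natCast_ne_top _) ?_
    calc ∫⁻ x, (weightSum T c (n + 1) x : ℝ≥0∞) ∂μ ≤ ∫⁻ _, ((n + 1 : ℕ) : ℝ≥0∞) ∂μ :=
          lintegral_mono fun x => by
            rw [← ENNReal.coe_natCast, ENNReal.coe_le_coe]
            exact weightSum_le T c hc1 (n + 1) x
      _ = _ := by simp
  have hpt : ∀ x, (weightSum T c (n + 1) x : ℝ≥0∞) +
      A.indicator (fun y => ((1 - θ : ℝ≥0) : ℝ≥0∞) * weightSum T c n (T y)) x =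
      1 + weightSum T c n (T x) := fun x => by
    rw [weightSum_succ]
    by_cases hx : x ∈ A
    · rw [Set.indicator_of_mem hx, hcA x hx]
      norm_cast
      rw [add_assoc, ← add_mul, add_tsub_cancel_of_le hθ, one_mul]
    · rw [Set.indicator_of_notMem hx, hc x hx]
      simp
  have hint := lintegral_congr (μ := μ) hpt
  rw [lintegral_add_left (hm _).coe_nnreal_ennreal, lintegral_add_left measurable_const,
    lintegral_indicator hA, lintegral_const_mul _ hmT, hcomp] at hint
  have hle : ∫⁻ x, (weightSum T c n x : ℝ≥0∞) ∂μ ≤ ∫⁻ x, (weightSum T c (n + 1) x : ℝ≥0∞) ∂μ :=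
    lintegral_mono fun x => ENNReal.coe_le_coe.2 (weightSum_mono T c x n.le_succ)
  refine (ENNReal.add_le_add_iff_left hfin).1 ?_
  rw [hint, add_comm]
  simpa using add_le_add_left hle 1

theorem Ergodic.ae_exists_weightSum_le {α : Type*} [MeasurableSpace α] {μ : Measure α}
    [IsProbabilityMeasure μ] {T : α → α} (hT : Ergodic T μ) {A : Set α}
    (hA : MeasurableSet A) (hμA : μ A ≠ 0) {c : α → ℝ≥0} (hcm : Measurable c) {θ : ℝ≥0}
    (h_pos : 0 < θ) (hθ : θ < 1) (hcA : ∀ x ∈ A, c x = θ) (hc : ∀ x ∉ A, c x = 1) :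
    ∀ᵐ x ∂μ, ∃ S : ℝ≥0, ∀ n, weightSum T c n x ≤ S := by
  have hm := measurable_weightSum hT.measurable hcm
  set E : Set α := {x | ∃ S : ℝ≥0, ∀ n, weightSum T c n x ≤ S} with hE
  have hEsup : E = {x | ⨆ n, (weightSum T c n x : ℝ≥0∞) < ∞} := by
    ext x
    simp only [hE, Set.mem_ofPred_eq]
    constructor
    · rintro ⟨S, hS⟩
      exact (iSup_le fun n => ENNReal.coe_le_coe.2 (hS n)).trans_lt ENNReal.coe_lt_top
    · intro h
      lift (⨆ n, (weightSum T c n x : ℝ≥0∞)) to ℝ≥0 using h.ne with S hS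
      refine ⟨S, fun n => ?_⟩
      rw [← ENNReal.coe_le_coe, hS]
      exact le_iSup (fun n => (weightSum T c n x : ℝ≥0∞)) n
  have hEm : MeasurableSet E := by
    rw [hEsup]
    exact measurableSet_lt (Measurable.iSup fun n => (hm n).coe_nnreal_ennreal) measurable_const
  have hc0 : ∀ x, 0 < c x := fun x => by
    by_cases hx : x ∈ A
    · rw [hcA x hx]; exact h_pos
    · rw [hc x hx]; exact one_pos
  have hinv : T ⁻¹' E = E := by
    ext x
    constructor
    · rintro ⟨S, hS⟩
      refine ⟨1 + c x * S, fun n => (weightSum_mono T c x n.le_succ).trans ?_⟩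
      simp only [weightSum_succ]
      gcongr
      exact hS n
    · rintro ⟨S, hS⟩
      refine ⟨S / c x, fun n => ?_⟩
      rw [le_div_iff₀ (hc0 x), mul_comm]
      have := hS (n + 1)
      rw [weightSum_succ] at this
      exact le_add_self.trans this
  rcases hT.toPreErgodic.ae_mem_or_ae_notMem hEm hinv with h | h
  · exact h
  · exfalso
    have hmT : ∀ n, Measurable fun x => (weightSum T c n (T x) : ℝ≥0∞) := fun n =>
      ((hm n).comp hT.measurable).coe_nnreal_ennreal
    have hbound : ((1 - θ : ℝ≥0) : ℝ≥0∞) *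
        ∫⁻ x in A, ⨆ n, (weightSum T c n (T x) : ℝ≥0∞) ∂μ ≤ 1 := by
      rw [lintegral_iSup hmT
        (fun m n hmn x => ENNReal.coe_le_coe.2 (weightSum_mono T c _ hmn)), ENNReal.mul_iSup]
      exact iSup_le fun n =>
        setLIntegral_weightSum_le hT.toMeasurePreserving hA hcm hθ.le hcA hc n
    have hne : ((1 - θ : ℝ≥0) : ℝ≥0∞) ≠ 0 :=
      ENNReal.coe_ne_zero.2 (tsub_pos_of_lt hθ).ne'
    have hfin : ∫⁻ x in A, ⨆ n, (weightSum T c n (T x) : ℝ≥0∞) ∂μ ≠ ∞ := fun htop => by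
      rw [htop, ENNReal.mul_top hne] at hbound
      exact absurd hbound (by simp)
    have hae : ∀ᵐ x ∂μ.restrict A, ⨆ n, (weightSum T c n (T x) : ℝ≥0∞) < ∞ :=
      ae_lt_top (Measurable.iSup hmT) hfin
    have hfalse : ∀ᵐ x ∂μ.restrict A, False := by
      filter_upwards [hae, ae_restrict_of_ae h] with x hx hx'
      refine hx' ?_
      rw [← hinv, Set.mem_preimage, hEsup]
      exact hx
    rw [ae_iff] at hfalse
    simp only [not_false_eq_true, Set.ofPred_true, Measure.restrict_apply_univ] at hfalse
    exact hμA hfalse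

/-! ### Linear functionals on words -/

/-- The value on a word of the additive functional with values `x` on letters. -/
def wordSum (x : Fin 3 → ℝ) (w : List (Fin 3)) : ℝ := (w.map x).sum

lemma wordSum_append (x : Fin 3 → ℝ) (u v : List (Fin 3)) :
    wordSum x (u ++ v) = wordSum x u + wordSum x v := by
  simp [wordSum]

/-- The pull-back of a functional by a substitution. -/
def pull (τ : Fin 3 → List (Fin 3)) (x : Fin 3 → ℝ) : Fin 3 → ℝ := fun a => wordSum x (τ a)

lemma wordSum_subApply (τ : Fin 3 → List (Fin 3)) (x : Fin 3 → ℝ) (w : List (Fin 3)) :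
    wordSum x (subApply τ w) = wordSum (pull τ x) w := by
  induction w with
  | nil => rfl
  | cons a w ih =>
    have : subApply τ (a :: w) = τ a ++ subApply τ w := rfl
    rw [this, wordSum_append, ih]
    simp [wordSum, pull]

lemma pull_dirProd_succ (σ : ℕ → Fin 3 → List (Fin 3)) (x : Fin 3 → ℝ) (n : ℕ) :
    pull (dirProd σ (n + 1)) x = pull (σ n) (pull (dirProd σ n) x) :=
  funext fun _ => wordSum_subApply _ _ _

lemma pull_dirProd_zero (σ : ℕ → Fin 3 → List (Fin 3)) (x : Fin 3 → ℝ) :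
    pull (dirProd σ 0) x = x := by
  funext a
  simp [pull, dirProd, wordSum]

lemma pull_cSub_zero (x : Fin 3 → ℝ) : pull (cSub 0) x = ![x 0, x 0 + x 2, x 1] := by
  funext a
  fin_cases a <;> simp [pull, wordSum, cSub, c1]

lemma pull_cSub_one (x : Fin 3 → ℝ) : pull (cSub 1) x = ![x 1, x 0 + x 2, x 2] := by
  funext a
  fin_cases a <;> simp [pull, wordSum, cSub, c2]

/-- A functional that is neither positive on all letters nor negative on all letters. -/
def Mixed (x : Fin 3 → ℝ) : Prop := (∃ i, 0 ≤ x i) ∧ ∃ j, x j ≤ 0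

lemma Mixed.of_pull_cSub {s : Fin 2} {x : Fin 3 → ℝ} (h : Mixed (pull (cSub s) x)) : Mixed x := by
  obtain ⟨⟨i, hi⟩, j, hj⟩ := h
  constructor
  · by_contra! hx
    have h0 := hx 0
    have h1 := hx 1
    have h2 := hx 2
    fin_cases s <;> fin_cases i <;> simp [pull_cSub_zero, pull_cSub_one] at hi <;> linarith
  · by_contra! hx
    have h0 := hx 0
    have h1 := hx 1
    have h2 := hx 2
    fin_cases s <;> fin_cases j <;> simp [pull_cSub_zero, pull_cSub_one] at hj <;> linarith

/-- A norm on functionals that the two pull-backs do not increase on mixed functionals. -/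
def cNorm (x : Fin 3 → ℝ) : ℝ :=
  max (max |x 0 - x 1| |x 1 - x 2|) (max |x 0 - x 2| |x 0 - x 1 + x 2|)

lemma cNorm_le_iff {x : Fin 3 → ℝ} {B : ℝ} :
    cNorm x ≤ B ↔ (|x 0 - x 1| ≤ B ∧ |x 1 - x 2| ≤ B) ∧ |x 0 - x 2| ≤ B ∧
      |x 0 - x 1 + x 2| ≤ B := by
  simp [cNorm]

lemma cNorm_nonneg (x : Fin 3 → ℝ) : 0 ≤ cNorm x :=
  (abs_nonneg _).trans (cNorm_le_iff.1 le_rfl).1.1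

lemma Mixed.abs_le_cNorm {x : Fin 3 → ℝ} (h : Mixed x) (a : Fin 3) : |x a| ≤ cNorm x := by
  obtain ⟨⟨h1, h2⟩, h3, -⟩ := (cNorm_le_iff (x := x)).1 le_rfl
  obtain ⟨⟨i, hi⟩, j, hj⟩ := h
  simp only [abs_le] at *
  fin_cases i <;> fin_cases j <;> fin_cases a <;> simp at * <;> constructor <;> linarith

lemma Mixed.cNorm_pull_le {s : Fin 2} {x : Fin 3 → ℝ} (h : Mixed x) :
    cNorm (pull (cSub s) x) ≤ cNorm x := by
  have hx0 := abs_le.1 (h.abs_le_cNorm 0)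
  have hx2 := abs_le.1 (h.abs_le_cNorm 2)
  obtain ⟨⟨h1, h2⟩, h3, h4⟩ := (cNorm_le_iff (x := x)).1 le_rfl
  rw [cNorm_le_iff]
  simp only [abs_le] at *
  fin_cases s <;> simp [pull_cSub_zero, pull_cSub_one] <;>
    refine ⟨⟨⟨?_, ?_⟩, ?_, ?_⟩, ⟨?_, ?_⟩, ?_, ?_⟩ <;> linarith

/-- The contraction along the word `12121212`. -/
lemma cNorm_contract {x y : Fin 3 → ℝ} (hy : y = ![4 * x 0 + 3 * x 1 + 2 * x 2,
    5 * x 0 + 4 * x 1 + 3 * x 2, 3 * x 0 + 2 * x 1 + 2 * x 2]) (h : Mixed y) :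
    cNorm y ≤ 4 / 7 * cNorm x := by
  obtain ⟨⟨h1, h2⟩, h3, h4⟩ := (cNorm_le_iff (x := x)).1 le_rfl
  obtain ⟨⟨i, hi⟩, j, hj⟩ := h
  rw [cNorm_le_iff]
  subst hy
  simp only [abs_le] at *
  obtain ⟨h1, h1'⟩ := h1
  obtain ⟨h2, h2'⟩ := h2
  obtain ⟨h3, h3'⟩ := h3
  obtain ⟨h4, h4'⟩ := h4
  fin_cases i <;> fin_cases j <;> simp at hi hj ⊢ <;>
    refine ⟨⟨⟨?_, ?_⟩, ?_, ?_⟩, ⟨?_, ?_⟩, ?_, ?_⟩ <;> linarith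

/-! ### Balance along a directive sequence -/

lemma abs_wordSum_prefix_le (i : ℕ → Fin 2) (x : Fin 3 → ℝ) (b : ℕ → ℝ) (N : ℕ)
    (hb : ∀ k ≤ N, ∀ a, |pull (dirProd (fun m => cSub (i m)) k) x a| ≤ b k) :
    ∀ n ≤ N, ∀ (a : Fin 3) (p : List (Fin 3)), p <+: dirProd (fun m => cSub (i m)) n a →
      |wordSum x p| ≤ b 0 + ∑ k ∈ Finset.range n, b k := by
  have hb0 : ∀ k ≤ N, 0 ≤ b k := fun k hk => (abs_nonneg _).trans (hb k hk 0)
  intro n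
  induction n with
  | zero =>
    intro hn a p hp
    have h0 := hb 0 hn a
    rw [pull_dirProd_zero] at h0
    have hp' : p <+: [a] := hp
    rcases p with _ | ⟨c, p⟩
    · simpa [wordSum] using hb0 0 hn
    · obtain ⟨rfl, hp''⟩ := List.cons_prefix_cons.1 hp'
      obtain rfl := List.prefix_nil.1 hp''
      simpa [wordSum] using h0
  | succ n ih =>
    intro hn a p hp
    have hn' : n ≤ N := (Nat.le_succ n).trans hn
    have hbn := hb0 n hn'
    rw [Finset.sum_range_succ, ← add_assoc]
    have single : ∀ c : Fin 3, p <+: dirProd (fun m => cSub (i m)) n c →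
        |wordSum x p| ≤ b 0 + ∑ k ∈ Finset.range n, b k + b n := fun c hc =>
      (ih hn' c p hc).trans (by linarith)
    have hform : (∃ c, cSub (i n) a = [c]) ∨ ∃ c d, cSub (i n) a = [c, d] := by
      generalize i n = s
      fin_cases s <;> fin_cases a <;> simp [cSub, c1, c2]
    have hp' : p <+: subApply (dirProd (fun m => cSub (i m)) n) (cSub (i n) a) := hp
    rcases hform with ⟨c, hc⟩ | ⟨c, d, hc⟩
    · rw [hc] at hp'
      exact single c (by simpa [subApply] using hp')
    · rw [hc] at hp'
      have hp'' : p <+: dirProd (fun m => cSub (i m)) n c ++ dirProd (fun m => cSub (i m)) n d := by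
        simpa [subApply] using hp'
      have hc' := List.prefix_append (dirProd (fun m => cSub (i m)) n c)
        (dirProd (fun m => cSub (i m)) n d)
      rcases le_total p.length (dirProd (fun m => cSub (i m)) n c).length with h | h
      · exact single c (List.prefix_of_prefix_length_le hp'' hc' h)
      · obtain ⟨q, rfl⟩ := List.prefix_of_prefix_length_le hc' hp'' h
        have hq := (List.prefix_append_right_inj _).1 hp''
        rw [wordSum_append]
        refine (abs_add_le _ _).trans ?_
        have h1 : |wordSum x (dirProd (fun m => cSub (i m)) n c)| ≤ b n := hb n hn' c
        have h2 := ih hn' d q hq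
        linarith

lemma shift_iterate (j : ℕ) (i : ℕ → Fin 2) (k : ℕ) : shift^[j] i k = i (k + j) := by
  induction j generalizing i with
  | zero => rfl
  | succ j ih =>
    rw [Function.iterate_succ_apply, ih]
    exact congrArg i (by omega)

open Classical in
/-- The contraction weight attached to a visit of the cylinder. -/
def visitWeight (i : ℕ → Fin 2) : ℝ≥0 := if i ∈ cyl8 then 15 / 16 else 1

lemma visitWeight_le_one (i : ℕ → Fin 2) : visitWeight i ≤ 1 := by
  unfold visitWeight
  split_ifs
  · rw [← NNReal.coe_le_coe]; norm_num
  · exact le_rfl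

lemma le_visitWeight (i : ℕ → Fin 2) : 15 / 16 ≤ visitWeight i := by
  unfold visitWeight
  split_ifs
  · exact le_rfl
  · rw [← NNReal.coe_le_coe]; norm_num

lemma pull_dirProd_visit {i : ℕ → Fin 2} {k : ℕ} (h : shift^[k] i ∈ cyl8) (x : Fin 3 → ℝ) :
    let X := pull (dirProd (fun m => cSub (i m)) k) x
    pull (dirProd (fun m => cSub (i m)) (k + 8)) x = ![4 * X 0 + 3 * X 1 + 2 * X 2,
      5 * X 0 + 4 * X 1 + 3 * X 2, 3 * X 0 + 2 * X 1 + 2 * X 2] := by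
  intro X
  have e : ∀ r < 8, i (k + r) = if r % 2 = 0 then 0 else 1 := fun r hr => by
    rw [add_comm, ← shift_iterate k i r]
    exact h r hr
  have e0 := e 0 (by norm_num)
  have e1 := e 1 (by norm_num)
  have e2 := e 2 (by norm_num)
  have e3 := e 3 (by norm_num)
  have e4 := e 4 (by norm_num)
  have e5 := e 5 (by norm_num)
  have e6 := e 6 (by norm_num)
  have e7 := e 7 (by norm_num)
  norm_num at e0 e1 e2 e3 e4 e5 e6 e7
  rw [pull_dirProd_succ _ _ (k + 7), pull_dirProd_succ _ _ (k + 6), pull_dirProd_succ _ _ (k + 5),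
    pull_dirProd_succ _ _ (k + 4), pull_dirProd_succ _ _ (k + 3), pull_dirProd_succ _ _ (k + 2),
    pull_dirProd_succ _ _ (k + 1), pull_dirProd_succ _ _ k, e0, e1, e2, e3, e4, e5, e6, e7]
  simp only [pull_cSub_zero, pull_cSub_one]
  funext a
  fin_cases a <;> simp [X] <;> ring

lemma mixed_pull_dirProd {i : ℕ → Fin 2} {x : Fin 3 → ℝ} {n : ℕ}
    (h : Mixed (pull (dirProd (fun m => cSub (i m)) n) x)) :
    ∀ k ≤ n, Mixed (pull (dirProd (fun m => cSub (i m)) k) x) := fun k hk =>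
  Nat.decreasingInduction (motive := fun k _ => Mixed (pull (dirProd (fun m => cSub (i m)) k) x))
    (fun k _ ih => by rw [pull_dirProd_succ] at ih; exact ih.of_pull_cSub) h hk

lemma cNorm_pull_dirProd_antitone {i : ℕ → Fin 2} {x : Fin 3 → ℝ} {n : ℕ}
    (h : Mixed (pull (dirProd (fun m => cSub (i m)) n) x)) {k l : ℕ} (hkl : k ≤ l) (hl : l ≤ n) :
    cNorm (pull (dirProd (fun m => cSub (i m)) l) x) ≤
      cNorm (pull (dirProd (fun m => cSub (i m)) k) x) := by
  induction l, hkl using Nat.le_induction with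
  | base => exact le_rfl
  | succ l hkl ih =>
    rw [pull_dirProd_succ]
    exact (mixed_pull_dirProd h l (by omega)).cNorm_pull_le.trans (ih (by omega))

/-- The product of the visit weights along the first `k` shifts of `i`. -/
def visitProd (i : ℕ → Fin 2) (k : ℕ) : ℝ≥0 := ∏ j ∈ Finset.range k, visitWeight (shift^[j] i)

lemma visitProd_succ (i : ℕ → Fin 2) (k : ℕ) :
    visitProd i (k + 1) = visitProd i k * visitWeight (shift^[k] i) :=
  Finset.prod_range_succ _ _

lemma visitProd_antitone (i : ℕ → Fin 2) : Antitone (visitProd i) :=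
  antitone_nat_of_succ_le fun k => by
    rw [visitProd_succ]
    exact mul_le_of_le_one_right zero_le (visitWeight_le_one _)

lemma pow_mul_visitProd_le (i : ℕ → Fin 2) (k r : ℕ) :
    (15 / 16) ^ r * visitProd i k ≤ visitProd i (k + r) := by
  induction r with
  | zero => simp
  | succ r ih =>
    rw [← add_assoc, visitProd_succ, pow_succ, mul_right_comm]
    exact mul_le_mul' ih (le_visitWeight _)

lemma cNorm_pull_dirProd_le {i : ℕ → Fin 2} {x : Fin 3 → ℝ} {n : ℕ}
    (h : Mixed (pull (dirProd (fun m => cSub (i m)) n) x)) :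
    ∀ k ≤ n, cNorm (pull (dirProd (fun m => cSub (i m)) k) x) ≤ cNorm x * visitProd i (k - 7) := by
  intro k
  induction k using Nat.strong_induction_on with
  | _ k ih =>
    intro hk
    rcases Nat.lt_or_ge k 8 with hk8 | hk8
    · have := cNorm_pull_dirProd_antitone h (Nat.zero_le k) hk
      rw [pull_dirProd_zero] at this
      rw [show k - 7 = 0 by omega]
      simpa [visitProd] using this
    · obtain ⟨k, rfl⟩ := Nat.exists_eq_add_of_le' hk8
      rw [show k + 8 - 7 = k + 1 by omega]
      by_cases hv : shift^[k] i ∈ cyl8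
      · have hcon := cNorm_contract (pull_dirProd_visit hv x) (mixed_pull_dirProd h _ hk)
        have hprev := ih k (by omega) (by omega)
        have hw : (15 / 16 : ℝ≥0) ^ 8 * visitProd i (k - 7) ≤ visitProd i (k + 1) :=
          (pow_mul_visitProd_le i (k - 7) 8).trans (visitProd_antitone i (by omega))
        have hw' : (15 / 16 : ℝ) ^ 8 * visitProd i (k - 7) ≤ visitProd i (k + 1) := by
          exact_mod_cast hw
        have hpos : (0 : ℝ) ≤ visitProd i (k - 7) := NNReal.coe_nonneg _
        have hw'' : (4 / 7 : ℝ) * visitProd i (k - 7) ≤ visitProd i (k + 1) := by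
          refine le_trans ?_ hw'
          gcongr
          norm_num
        have hN := mul_le_mul_of_nonneg_left hw'' (cNorm_nonneg x)
        linarith
      · rw [visitProd_succ, show visitWeight (shift^[k] i) = 1 by simp [visitWeight, hv], mul_one]
        have hprev := ih (k + 7) (by omega) (by omega)
        rw [Nat.add_sub_cancel] at hprev
        exact (cNorm_pull_dirProd_antitone h (by omega) hk).trans hprev

lemma sum_visitProd_sub_le (i : ℕ → Fin 2) (n : ℕ) :
    ∑ k ∈ Finset.range n, visitProd i (k - 7) ≤ 7 + weightSum shift visitWeight n i := by
  have h : ∑ k ∈ Finset.range (7 + n), visitProd i (k - 7) ≤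
      7 + weightSum shift visitWeight n i := by
    rw [Finset.sum_range_add]
    refine add_le_add ?_ (le_of_eq ?_)
    · simp [Finset.sum_range_succ, visitProd]
      norm_num
    · refine Finset.sum_congr rfl fun k _ => ?_
      rw [Nat.add_sub_cancel_left]
      rfl
  exact (Finset.sum_le_sum_of_subset (Finset.range_mono (Nat.le_add_left n 7))).trans h

/-- Prefixes of `dirProd σ n 0` have uniformly bounded image under a functional that vanishes on
the whole word. -/
lemma abs_wordSum_prefix_le_of_weightSum_le {i : ℕ → Fin 2} {S : ℝ≥0}
    (hS : ∀ n, weightSum shift visitWeight n i ≤ S) {x : Fin 3 → ℝ} {n : ℕ}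
    (hx : wordSum x (dirProd (fun m => cSub (i m)) n 0) = 0) {p : List (Fin 3)}
    (hp : p <+: dirProd (fun m => cSub (i m)) n 0) : |wordSum x p| ≤ cNorm x * (8 + S) := by
  have hmix : Mixed (pull (dirProd (fun m => cSub (i m)) n) x) := ⟨⟨0, hx.ge⟩, 0, hx.le⟩
  refine (abs_wordSum_prefix_le i x (fun k => cNorm x * visitProd i (k - 7)) n
    (fun k hk a => ((mixed_pull_dirProd hmix k hk).abs_le_cNorm a).trans
      (cNorm_pull_dirProd_le hmix k hk)) n le_rfl 0 p hp).trans ?_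
  have h1 : ∑ k ∈ Finset.range n, (visitProd i (k - 7) : ℝ) ≤ 7 + S := by
    exact_mod_cast (sum_visitProd_sub_le i n).trans (add_le_add_right (hS n) 7)
  rw [← Finset.mul_sum, ← mul_add]
  refine mul_le_mul_of_nonneg_left ?_ (cNorm_nonneg x)
  have h0 : (visitProd i (0 - 7) : ℝ) = 1 := by simp [visitProd]
  rw [h0]
  linarith

/-- The functional counting the letter `a`, corrected by a multiple of the length. -/
def letterDeviation (a : Fin 3) (t : ℝ) : Fin 3 → ℝ := fun b => (if b = a then 1 else 0) - t

lemma wordSum_letterDeviation (a : Fin 3) (t : ℝ) (w : List (Fin 3)) :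
    wordSum (letterDeviation a t) w = w.count a - t * w.length := by
  induction w with
  | nil => simp [wordSum]
  | cons b w ih =>
    have : wordSum (letterDeviation a t) (b :: w) =
      letterDeviation a t b + wordSum (letterDeviation a t) w := by simp [wordSum]
    rw [this, ih, List.count_cons]
    by_cases hb : b = a <;> simp [letterDeviation, hb] <;> ring

lemma cNorm_letterDeviation_le (a : Fin 3) {t : ℝ} (h_nonneg : 0 ≤ t) (h_le : t ≤ 1) :
    cNorm (letterDeviation a t) ≤ 2 := by
  rw [cNorm_le_iff]
  simp only [abs_le]
  fin_cases a <;> simp [letterDeviation] <;>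
    and_intros <;> linarith

lemma abs_count_sub_count_le {i : ℕ → Fin 2} {S : ℝ≥0}
    (hS : ∀ n, weightSum shift visitWeight n i ≤ S) (n : ℕ) (a : Fin 3) {u v : List (Fin 3)}
    (huv : u.length = v.length) (hu : u <:+: dirProd (fun m => cSub (i m)) n 0)
    (hv : v <:+: dirProd (fun m => cSub (i m)) n 0) :
    |(u.count a : ℝ) - (v.count a : ℝ)| ≤ 8 * (8 + S) := by
  set W := dirProd (fun m => cSub (i m)) n 0 with hW
  set t : ℝ := (W.count a : ℝ) / W.length with ht
  have hcount : (W.count a : ℝ) ≤ W.length := by exact_mod_cast List.count_le_length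
  have h_nonneg : 0 ≤ t := by positivity
  have h_le : t ≤ 1 := div_le_one_of_le₀ hcount (Nat.cast_nonneg _)
  have hx : wordSum (letterDeviation a t) W = 0 := by
    rw [wordSum_letterDeviation]
    rcases eq_or_ne (W.length : ℝ) 0 with h | h
    · have hc : (W.count a : ℝ) = 0 := le_antisymm (hcount.trans h.le) (Nat.cast_nonneg _)
      rw [h, hc]; simp
    · rw [ht, div_mul_cancel₀ _ h, sub_self]
  have hpre : ∀ p, p <+: W → |wordSum (letterDeviation a t) p| ≤ 2 * (8 + S) := fun p hp =>
    (abs_wordSum_prefix_le_of_weightSum_le hS hx hp).trans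
      (mul_le_mul_of_nonneg_right (cNorm_letterDeviation_le a h_nonneg h_le) (by positivity))
  have hfac : ∀ w, w <:+: W → |wordSum (letterDeviation a t) w| ≤ 4 * (8 + S) := by
    rintro w ⟨s, r, hsr⟩
    have h1 := hpre s ⟨w ++ r, by rw [← hsr, List.append_assoc]⟩
    have h2 := hpre (s ++ w) ⟨r, hsr⟩
    rw [wordSum_append] at h2
    rw [abs_le] at *
    constructor <;> linarith
  have h1 := hfac u hu
  have h2 := hfac v hv
  rw [wordSum_letterDeviation] at h1 h2
  rw [huv] at h1
  rw [abs_le] at *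
  constructor <;> linarith

lemma measurableSet_cyl8 : MeasurableSet cyl8 := by
  have : cyl8 = ⋂ k : ℕ, ⋂ _ : k < 8,
      (fun γ : ℕ → Fin 2 => γ k) ⁻¹' {if k % 2 = 0 then 0 else 1} := by
    ext γ
    simp [cyl8]
  rw [this]
  exact MeasurableSet.iInter fun k => MeasurableSet.iInter fun _ =>
    measurable_pi_apply k (measurableSet_singleton _)

theorem almost_every_Cadic_word_is_balanced
    (μ : Measure (ℕ → Fin 2)) [IsProbabilityMeasure μ]
    (herg : Ergodic shift μ) (hcyl : 0 < μ cyl8) :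
    ∀ᵐ i ∂μ, ∃ C : ℝ, 0 < C ∧
      ∀ (n : ℕ) (a : Fin 3) (u v : List (Fin 3)),
        u.length = v.length →
        u <:+: dirProd (fun m => cSub (i m)) n 0 →
        v <:+: dirProd (fun m => cSub (i m)) n 0 →
        |(u.count a : ℝ) - (v.count a : ℝ)| ≤ C := by
  have hm : Measurable visitWeight :=
    Measurable.ite measurableSet_cyl8 measurable_const measurable_const
  have hθ : (15 / 16 : ℝ≥0) < 1 := by
    rw [← NNReal.coe_lt_coe]; norm_num
  have h := herg.ae_exists_weightSum_le measurableSet_cyl8 hcyl.ne' hm (by positivity) hθ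
    (fun x hx => if_pos hx) (fun x hx => if_neg hx)
  filter_upwards [h] with i ⟨S, hS⟩
  exact ⟨8 * (8 + S), by positivity, fun n a u v huv hu hv =>
    abs_count_sub_count_le hS n a huv hu hv⟩
end
end

section
/- Let (i_n) ∈ {1,2}^ℕ and let w ∈ {1,2,3}^ℕ be a C-adic word with directive sequence (c_{i_n}). Then the factor complexity of w satisfies p_w(n) = 2n+1 for every n ∈ ℕ if and only if the sequence of matrices (C_{i_n})_{n∈ℕ} is primitive. -/
open Matrix Filter MeasureTheory

noncomputable section

/-- The matrix `C1`. -/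
def C1 : Matrix (Fin 3) (Fin 3) ℝ := !![1,1,0; 0,0,1; 0,1,0]

/-- The matrix `C2`. -/
def C2 : Matrix (Fin 3) (Fin 3) ℝ := !![0,1,0; 1,0,0; 0,1,1]

/-- The product `M r * M (r+1) * ... * M (s-1)`. -/
def segProd (M : ℕ → Matrix (Fin 3) (Fin 3) ℝ) (r s : ℕ) : Matrix (Fin 3) (Fin 3) ℝ :=
  ((List.range (s - r)).map (fun k => M (r + k))).prod

/-- A sequence of nonnegative matrices is primitive if every tail has a finite
initial product with all entries positive. -/
def IsPrimitiveSeq (M : ℕ → Matrix (Fin 3) (Fin 3) ℝ) : Prop :=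
  ∀ r : ℕ, ∃ s : ℕ, r < s ∧ ∀ i j, 0 < segProd M r s i j

/-- The matrix indexed by an element of `{1,2}` (encoded as `Fin 2`). -/
def cMat : Fin 2 → Matrix (Fin 3) (Fin 3) ℝ := ![C1, C2]

/-- `LimitWord σ a w`: the words `σ 0 ∘ ... ∘ σ (n-1) (a n)` converge to the
infinite word `w`, i.e. for every `k` and all large enough `n`, the first `k`
letters of that word are defined and agree with `w`. -/
def LimitWord (σ : ℕ → (Fin 3 → List (Fin 3))) (a : ℕ → Fin 3) (w : ℕ → Fin 3) : Prop :=
  ∀ k : ℕ, ∃ N : ℕ, ∀ n ≥ N,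
    k ≤ (dirProd σ n (a n)).length ∧ ∀ j < k, (dirProd σ n (a n))[j]? = some (w j)

/-- The factor `w k, w (k+1), ..., w (k+n-1)` of an infinite word `w`. -/
def win (w : ℕ → Fin 3) (k n : ℕ) : List (Fin 3) :=
  (List.range n).map (fun j => w (k + j))

/-- The factor complexity of an infinite word `w`. -/
def complexity (w : ℕ → Fin 3) (n : ℕ) : ℕ :=
  Set.ncard {u : List (Fin 3) | ∃ k : ℕ, u = win w k n}

/-! ### Extension graphs -/

/-- A bipartite graph on two copies of the alphabet: `eab` tells whether there is an edge between
the left vertex `a` and the right vertex `b`. -/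
structure ExtGraph where
  (e00 e01 e02 e10 e11 e12 e20 e21 e22 : Bool)

namespace ExtGraph

/-- Adjacency of the left vertex `a` and the right vertex `b`. -/
def adj (e : ExtGraph) : Fin 3 → Fin 3 → Bool :=
  ![![e.e00, e.e01, e.e02], ![e.e10, e.e11, e.e12], ![e.e20, e.e21, e.e22]]

/-- The graph with the given adjacency. -/
def ofAdj (f : Fin 3 → Fin 3 → Bool) : ExtGraph :=
  ⟨f 0 0, f 0 1, f 0 2, f 1 0, f 1 1, f 1 2, f 2 0, f 2 1, f 2 2⟩

theorem adj_ofAdj (f : Fin 3 → Fin 3 → Bool) (a b : Fin 3) : (ofAdj f).adj a b = f a b := by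
  fin_cases a <;> fin_cases b <;> rfl

theorem ext_adj {e e' : ExtGraph} (h : ∀ a b, e.adj a b = true ↔ e'.adj a b = true) : e = e' := by
  have h' : ∀ a b, e.adj a b = e'.adj a b := fun a b => Bool.eq_iff_iff.2 (h a b)
  cases e
  cases e'
  rw [mk.injEq]
  exact ⟨h' 0 0, h' 0 1, h' 0 2, h' 1 0, h' 1 1, h' 1 2, h' 2 0, h' 2 1, h' 2 2⟩

/-- Number of edges. -/
def edgeCount (e : ExtGraph) : ℕ :=
  e.e00.toNat + e.e01.toNat + e.e02.toNat + e.e10.toNat + e.e11.toNat + e.e12.toNat +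
    e.e20.toNat + e.e21.toNat + e.e22.toNat

/-- Number of non-isolated left vertices. -/
def leftCount (e : ExtGraph) : ℕ :=
  (e.e00 || e.e01 || e.e02).toNat + (e.e10 || e.e11 || e.e12).toNat +
    (e.e20 || e.e21 || e.e22).toNat

/-- Number of non-isolated right vertices. -/
def rightCount (e : ExtGraph) : ℕ :=
  (e.e00 || e.e10 || e.e20).toNat + (e.e01 || e.e11 || e.e21).toNat +
    (e.e02 || e.e12 || e.e22).toNat

/-- Whether two of the three Booleans are true. -/
def two (x y z : Bool) : Bool := x && y || x && z || y && z

/-- Whether two right vertices have at least two common neighbours. -/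
def hasSquare (e : ExtGraph) : Bool :=
  two (e.e00 && e.e01) (e.e10 && e.e11) (e.e20 && e.e21) ||
  two (e.e00 && e.e02) (e.e10 && e.e12) (e.e20 && e.e22) ||
  two (e.e01 && e.e02) (e.e11 && e.e12) (e.e21 && e.e22)

/-- Left vertices `1` and `2` have a common neighbour as soon as each of them has a common
neighbour with the left vertex `0`. -/
def leftClosed (e : ExtGraph) : Bool :=
  !(e.e00 && e.e10 || e.e01 && e.e11 || e.e02 && e.e12) ||
  !(e.e00 && e.e20 || e.e01 && e.e21 || e.e02 && e.e22) ||
  (e.e10 && e.e20 || e.e11 && e.e21 || e.e12 && e.e22)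

/-- The transposed graph, with the letters `0` and `2` exchanged. -/
def mirror (e : ExtGraph) : ExtGraph :=
  ⟨e.e22, e.e12, e.e02, e.e21, e.e11, e.e01, e.e20, e.e10, e.e00⟩

/-- The extension graph of `c1 v` in terms of that of `v`. -/
def merge (e : ExtGraph) : ExtGraph :=
  ⟨e.e00 || e.e01, e.e02, false, e.e20 || e.e21, e.e22, false, e.e10 || e.e11, e.e12, false⟩

/-- The extension graph of `c1 v ++ [0]` in terms of that of `v`. -/
def restrict (e : ExtGraph) : ExtGraph :=
  ⟨false, e.e00, e.e01, false, e.e20, e.e21, false, e.e10, e.e11⟩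

/-- A nonempty forest satisfying closure conditions that are stable under `mirror`, `merge` and
`restrict`. -/
def good (e : ExtGraph) : Bool :=
  Nat.ble 1 e.edgeCount && Nat.ble e.edgeCount 5 && !e.hasSquare && e.leftClosed &&
    e.mirror.leftClosed && e.merge.leftClosed && e.mirror.merge.leftClosed

/-- Euler characteristic one. -/
def neutral (e : ExtGraph) : Bool := Nat.beq (e.edgeCount + 1) (e.leftCount + e.rightCount)

/-- The extension graph of the empty word in the image under `c1`; the Boolean tells whether the
letter `1` occurs. -/
def step1 (f : Bool) (e : ExtGraph) : ExtGraph := { e.merge with e02 := f }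

/-- The extension graph of the empty word in the image under `cSub j`; the Boolean tells whether
the letter `1` occurs. -/
def step (j : Fin 2) (f : Bool) (e : ExtGraph) : ExtGraph :=
  if j = 0 then e.step1 f else (e.mirror.step1 f).mirror

/-- The last letter of `c1 a`; this is an involution. -/
def swapLast : Fin 3 → Fin 3 := ![0, 2, 1]

theorem adj_mirror (e : ExtGraph) (a b : Fin 3) : e.mirror.adj a b = e.adj b.rev a.rev := by
  fin_cases a <;> fin_cases b <;> rfl

theorem adj_merge (e : ExtGraph) (a b : Fin 3) : e.merge.adj a b =
    ![e.adj (swapLast a) 0 || e.adj (swapLast a) 1, e.adj (swapLast a) 2, false] b := by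
  fin_cases a <;> fin_cases b <;> rfl

theorem adj_restrict (e : ExtGraph) (a b : Fin 3) : e.restrict.adj a b =
    ![false, e.adj (swapLast a) 0, e.adj (swapLast a) 1] b := by
  fin_cases a <;> fin_cases b <;> rfl

theorem adj_step1 (f : Bool) (e : ExtGraph) (a b : Fin 3) :
    (e.step1 f).adj a b = (f && a == 0 && b == 2 || e.merge.adj a b) := by
  fin_cases a <;> fin_cases b <;> cases f <;> rfl

theorem forall_of_mk {p : ExtGraph → Prop}
    (h : ∀ x0 x1 x2 x3 x4 x5 x6 x7 x8, p ⟨x0, x1, x2, x3, x4, x5, x6, x7, x8⟩) (e : ExtGraph) :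
    p e := h ..

theorem good_of_leftCount_le : ∀ e : ExtGraph,
    1 ≤ e.edgeCount → e.leftCount ≤ 1 → e.good ∧ e.neutral := by
  apply forall_of_mk; decide +kernel

theorem good_of_rightCount_le : ∀ e : ExtGraph,
    1 ≤ e.edgeCount → e.rightCount ≤ 1 → e.good ∧ e.neutral := by
  apply forall_of_mk; decide +kernel

theorem good_mirror : ∀ e : ExtGraph, e.mirror.good = e.good := by
  apply forall_of_mk; decide +kernel

theorem neutral_mirror : ∀ e : ExtGraph, e.mirror.neutral = e.neutral := by
  apply forall_of_mk; decide +kernel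

theorem good_merge : ∀ e : ExtGraph, e.good → e.merge.good := by
  apply forall_of_mk; decide +kernel

theorem good_restrict : ∀ e : ExtGraph, e.good → 1 ≤ e.restrict.edgeCount → e.restrict.good := by
  apply forall_of_mk; decide +kernel

theorem neutral_merge : ∀ e : ExtGraph, e.good → e.neutral → e.merge.neutral := by
  apply forall_of_mk; decide +kernel

theorem neutral_restrict : ∀ e : ExtGraph,
    e.good → e.neutral → 1 ≤ e.restrict.edgeCount → e.restrict.neutral := by
  apply forall_of_mk; decide +kernel

theorem neutral_of_merge_of_restrict : ∀ e : ExtGraph, e.good → e.merge.neutral →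
    (1 ≤ e.restrict.edgeCount → e.restrict.neutral) → e.neutral := by
  apply forall_of_mk; decide +kernel

theorem neutral_merge_of_step1 : ∀ e : ExtGraph, e.good → (e.e00 || e.e01 || e.e02) →
    (e.step1 true).neutral → e.merge.neutral := by
  apply forall_of_mk; decide +kernel

theorem good_le : ∀ e : ExtGraph, e.good → e.edgeCount + 1 ≤ e.leftCount + e.rightCount := by
  apply forall_of_mk; decide +kernel

/-- The constraints on the extension graph of the empty word in an image under `cSub k`. -/
def stepRange (k : Fin 2) (e : ExtGraph) : Bool :=
  if k = 0 then !e.e12 && !e.e22 else !e.e00 && !e.e01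

theorem stepRange_step (k : Fin 2) (f : Bool) : ∀ e : ExtGraph, stepRange k (step k f e) := by
  apply forall_of_mk; revert k f; decide +kernel

/-- The constraints of `stepRange` and those arising when all vertices have edges. -/
def fullRange (k : Fin 2) (e : ExtGraph) : Bool :=
  stepRange k e && e.e02 && (if k = 0 then e.e00 || e.e01 else e.e12 || e.e22) &&
    e.leftCount == 3 && e.rightCount == 3

theorem fullRange_step (k : Fin 2) : ∀ e : ExtGraph, e.leftCount = 3 → e.rightCount = 3 →
    fullRange k (step k true e) := by
  apply forall_of_mk; revert k; decide +kernel

theorem good_step_step (i j k : Fin 2) (f g : Bool) : ∀ e : ExtGraph, 1 ≤ e.edgeCount →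
    stepRange k e → (step i f (step j g e)).good := by
  apply forall_of_mk; revert i j k f g; decide +kernel

theorem neutral_step_step (i j k : Fin 2) : ∀ e : ExtGraph, fullRange k e →
    (step i true (step j true e)).neutral := by
  apply forall_of_mk; revert i j k; decide +kernel

theorem not_neutral_of_missing : ∀ e : ExtGraph, e.good → e.leftCount = 3 → e.rightCount = 3 →
    e.e00 = false → e.e01 = false → e.e12 = false → e.e22 = false → e.neutral = false := by
  apply forall_of_mk; decide +kernel

theorem not_neutral_of_missing' : ∀ e : ExtGraph, e.good → e.leftCount = 3 → e.rightCount = 3 →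
    e.e00 = false → e.e11 = false → e.e12 = false → e.e21 = false → e.e22 = false →
    e.neutral = false := by
  apply forall_of_mk; decide +kernel

end ExtGraph

/-! ### Languages and marked substitutions -/

theorem subApply_nil (c : Fin 3 → List (Fin 3)) : subApply c [] = [] := rfl

theorem subApply_cons (c : Fin 3 → List (Fin 3)) (a : Fin 3) (v : List (Fin 3)) :
    subApply c (a :: v) = c a ++ subApply c v := List.flatMap_cons

theorem subApply_append (c : Fin 3 → List (Fin 3)) (u v : List (Fin 3)) :
    subApply c (u ++ v) = subApply c u ++ subApply c v := List.flatMap_append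

theorem subApply_singleton (c : Fin 3 → List (Fin 3)) (a : Fin 3) : subApply c [a] = c a := by
  simp [subApply]

theorem subApply_subApply (c d : Fin 3 → List (Fin 3)) (v : List (Fin 3)) :
    subApply c (subApply d v) = subApply (fun a => subApply c (d a)) v := List.flatMap_assoc

theorem subApply_infix_subApply (c : Fin 3 → List (Fin 3)) {u v : List (Fin 3)} (h : u <:+: v) :
    subApply c u <:+: subApply c v := by
  obtain ⟨s, t, rfl⟩ := h
  exact ⟨subApply c s, subApply c t, by simp only [subApply_append]⟩

/-- The set of factors of the images of the words of `L`. -/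
def imageLang (c : Fin 3 → List (Fin 3)) (L : Set (List (Fin 3))) : Set (List (Fin 3)) :=
  {u | ∃ v ∈ L, u <:+: subApply c v}

theorem subApply_mem_imageLang {c : Fin 3 → List (Fin 3)} {L : Set (List (Fin 3))}
    {v : List (Fin 3)} (h : v ∈ L) {u : List (Fin 3)} (hu : u <:+: subApply c v) :
    u ∈ imageLang c L := ⟨v, h, hu⟩

theorem imageLang_imageLang (c d : Fin 3 → List (Fin 3)) (L : Set (List (Fin 3))) :
    imageLang c (imageLang d L) = imageLang (fun a => subApply c (d a)) L := by
  ext u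
  constructor
  · rintro ⟨v, ⟨z, hz, hv⟩, hu⟩
    exact ⟨z, hz, subApply_subApply c d z ▸ hu.trans (subApply_infix_subApply c hv)⟩
  · rintro ⟨z, hz, hu⟩
    exact ⟨subApply d z, ⟨z, hz, List.infix_refl _⟩, by rwa [subApply_subApply]⟩

/-- A nonempty factorial language all of whose words can be extended on both sides. -/
structure IsBiextendable (L : Set (List (Fin 3))) : Prop where
  nil_mem : [] ∈ L
  infix_mem : ∀ {u v : List (Fin 3)}, v ∈ L → u <:+: v → u ∈ L
  left_mem : ∀ {u : List (Fin 3)}, u ∈ L → ∃ a, a :: u ∈ L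
  right_mem : ∀ {u : List (Fin 3)}, u ∈ L → ∃ b, u ++ [b] ∈ L

theorem IsBiextendable.both_mem {L : Set (List (Fin 3))} (hL : IsBiextendable L)
    {u : List (Fin 3)} (hu : u ∈ L) : ∃ a b, a :: (u ++ [b]) ∈ L := by
  obtain ⟨b, hb⟩ := hL.right_mem hu
  obtain ⟨a, ha⟩ := hL.left_mem hb
  exact ⟨a, b, ha⟩

open Classical in
/-- The extension graph of the word `u` in the language `L`. -/
def extGraph (L : Set (List (Fin 3))) (u : List (Fin 3)) : ExtGraph :=
  ExtGraph.ofAdj fun a b => decide (a :: (u ++ [b]) ∈ L)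

theorem extGraph_adj {L : Set (List (Fin 3))} {u : List (Fin 3)} {a b : Fin 3} :
    (extGraph L u).adj a b = true ↔ a :: (u ++ [b]) ∈ L := by
  simp [extGraph, ExtGraph.adj_ofAdj]

/-- Every image under `c` starts with a letter of `B` and has no other letter of `B`. -/
def IsMarked (c : Fin 3 → List (Fin 3)) (B : Fin 3 → Prop) : Prop :=
  ∀ a, ∃ h t, c a = h :: t ∧ B h ∧ ∀ x ∈ t, ¬ B x

theorem IsMarked.split {c : Fin 3 → List (Fin 3)} {B : Fin 3 → Prop} (hc : IsMarked c B)
    {V P Q : List (Fin 3)} {q : Fin 3} (hq : B q) (h : subApply c V = P ++ q :: Q) :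
    ∃ V₁ V₂, V = V₁ ++ V₂ ∧ P = subApply c V₁ ∧ q :: Q = subApply c V₂ := by
  induction V generalizing P with
  | nil => simp [subApply] at h
  | cons x V ih =>
    obtain ⟨b, t, hx, hb, ht⟩ := hc x
    rcases P with _ | ⟨p, P⟩
    · exact ⟨[], x :: V, rfl, rfl, h.symm⟩
    · rw [subApply_cons, hx, List.cons_append, List.cons_append, List.cons.injEq] at h
      obtain ⟨rfl, h⟩ := h
      have key : ∃ k, P = t ++ k ∧ subApply c V = k ++ q :: Q := by
        rcases List.append_eq_append_iff.1 h with ⟨k, h1, h2⟩ | ⟨k, h1, h2⟩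
        · exact ⟨k, h1, h2⟩
        · rcases k with _ | ⟨y, k⟩
          · exact ⟨[], by simpa using h1.symm, by simpa using h2.symm⟩
          · rw [List.cons_append, List.cons.injEq] at h2
            exact absurd hq (ht q (by rw [h1, h2.1]; simp))
      obtain ⟨k, rfl, h2⟩ := key
      obtain ⟨V₁, V₂, rfl, rfl, h3⟩ := ih h2
      exact ⟨x :: V₁, V₂, rfl, by rw [subApply_cons, hx]; rfl, h3⟩

theorem IsMarked.injective {c : Fin 3 → List (Fin 3)} {B : Fin 3 → Prop} (hc : IsMarked c B)
    (hinj : Function.Injective c) {u v : List (Fin 3)} (h : subApply c u = subApply c v) :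
    u = v := by
  induction u generalizing v with
  | nil =>
    rcases v with _ | ⟨y, v⟩
    · rfl
    · obtain ⟨b, t, hy, -⟩ := hc y
      rw [subApply_cons, hy] at h
      simp [subApply] at h
  | cons x u ih =>
    rcases v with _ | ⟨y, v⟩
    · obtain ⟨b, t, hx, -⟩ := hc x
      rw [subApply_cons, hx] at h
      simp [subApply] at h
    · have hlen : (c x).length = (c y).length := by
        obtain ⟨b, t, hx, hb, ht⟩ := hc x
        obtain ⟨b', t', hy, hb', ht'⟩ := hc y
        rw [subApply_cons, subApply_cons, hx, hy, List.cons_append, List.cons_append,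
          List.cons.injEq] at h
        have aux : ∀ {s s' k : List (Fin 3)} {w z : List (Fin 3)},
            s' = s ++ k → subApply c w = k ++ z → (∀ x ∈ s', ¬ B x) → k = [] := by
          intro s s' k w z h1 h2 h3
          rcases k with _ | ⟨y, k⟩
          · rfl
          · rcases w with _ | ⟨x, w⟩
            · simp [subApply] at h2
            · obtain ⟨b, t, hx, hb, -⟩ := hc x
              rw [subApply_cons, hx, List.cons_append, List.cons_append, List.cons.injEq] at h2
              exact absurd hb (h3 b (by rw [h1, h2.1]; simp))
        rw [hx, hy, List.length_cons, List.length_cons]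
        rcases List.append_eq_append_iff.1 h.2 with ⟨k, h1, h2⟩ | ⟨k, h1, h2⟩
        · rw [h1, aux h1 h2 ht', List.append_nil]
        · rw [h1, aux h1 h2 ht, List.append_nil]
      rw [subApply_cons, subApply_cons] at h
      obtain ⟨h1, h2⟩ := List.append_inj h hlen
      rw [hinj h1, ih h2]

theorem IsMarked.parse {c : Fin 3 → List (Fin 3)} {B : Fin 3 → Prop} (hc : IsMarked c B)
    {L : Set (List (Fin 3))} (hL : IsBiextendable L) {a q : Fin 3} {u r : List (Fin 3)}
    (h : a :: (u ++ q :: r) ∈ imageLang c L) (hu : ∀ x ∈ u.head?, B x) (hq : B q) :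
    ∃ a' v V, a' :: (v ++ V) ∈ L ∧ u = subApply c v ∧ (c a').getLast? = some a ∧
      q :: r <+: subApply c V := by
  obtain ⟨V, hV, l, r', hW⟩ := h
  have h1 : ∃ V₁ V₂, V = V₁ ++ V₂ ∧ l ++ [a] = subApply c V₁ ∧
      u ++ q :: (r ++ r') = subApply c V₂ := by
    rcases u with _ | ⟨x, u⟩
    · obtain ⟨V₁, V₂, h1, h2, h3⟩ := hc.split (P := l ++ [a]) (Q := r ++ r') hq
        (by rw [← hW]; simp)
      exact ⟨V₁, V₂, h1, h2, h3⟩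
    · obtain ⟨V₁, V₂, h1, h2, h3⟩ := hc.split (P := l ++ [a]) (Q := u ++ q :: (r ++ r'))
        (hu x (by simp)) (V := V) (by rw [← hW]; simp)
      exact ⟨V₁, V₂, h1, h2, h3⟩
  obtain ⟨V₁, V₂, rfl, h2, h3⟩ := h1
  obtain ⟨v, V₃, rfl, h4, h5⟩ := hc.split hq h3.symm
  rcases List.eq_nil_or_concat V₁ with rfl | ⟨V₁, a', rfl⟩
  · simp [subApply] at h2
  refine ⟨a', v, V₃, hL.infix_mem hV ⟨V₁, [], by simp⟩, h4, ?_, ⟨r', by rw [← h5]; simp⟩⟩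
  obtain ⟨b, t, hb, -⟩ := hc a'
  rw [List.concat_eq_append, subApply_append, subApply_singleton] at h2
  have := congrArg List.getLast? h2
  rw [List.getLast?_append_of_ne_nil _ (by simp), List.getLast?_append_of_ne_nil _ (by simp [hb])]
    at this
  simpa using this.symm

theorem pair_infix_append {a b : Fin 3} {P Q : List (Fin 3)} (h : [a, b] <:+: P ++ Q) :
    [a, b] <:+: P ∨ [a, b] <:+: Q ∨ (P.getLast? = some a ∧ Q.head? = some b) := by
  obtain ⟨s, t, h⟩ := h
  rw [List.append_assoc] at h
  rcases List.append_eq_append_iff.1 h with ⟨k, h1, h2⟩ | ⟨k, h1, h2⟩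
  · rcases k with _ | ⟨x, _ | ⟨y, k⟩⟩
    · right; left
      exact ⟨[], t, by simpa using h2⟩
    · right; right
      simp only [List.cons_append, List.nil_append, List.cons.injEq] at h2
      obtain ⟨rfl, rfl⟩ := h2
      simp [h1]
    · left
      simp only [List.cons_append, List.nil_append, List.cons.injEq] at h2
      obtain ⟨rfl, rfl, -⟩ := h2
      exact ⟨s, k, by simp [h1]⟩
  · right; left
    exact ⟨k, t, by simp [h2]⟩

theorem pair_infix_subApply {c : Fin 3 → List (Fin 3)} (hc : ∀ a, c a ≠ []) {a b : Fin 3}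
    {V : List (Fin 3)} (h : [a, b] <:+: subApply c V) :
    (∃ x ∈ V, [a, b] <:+: c x) ∨
      ∃ x y, [x, y] <:+: V ∧ (c x).getLast? = some a ∧ (c y).head? = some b := by
  induction V with
  | nil => simp [subApply] at h
  | cons x V ih =>
    rw [subApply_cons] at h
    rcases pair_infix_append h with h | h | ⟨h1, h2⟩
    · exact Or.inl ⟨x, by simp, h⟩
    · rcases ih h with ⟨y, hy, h⟩ | ⟨y, z, hy, h⟩
      · exact Or.inl ⟨y, by simp [hy], h⟩
      · exact Or.inr ⟨y, z, hy.trans (List.infix_cons_iff.2 (Or.inr (List.infix_refl _))), h⟩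
    · rcases V with _ | ⟨y, V⟩
      · simp [subApply] at h2
      · refine Or.inr ⟨x, y, ⟨[], V, rfl⟩, h1, ?_⟩
        rwa [subApply_cons, List.head?_append_of_ne_nil _ (hc y)] at h2

theorem pair_mem_imageLang {c : Fin 3 → List (Fin 3)} (hc : ∀ a, c a ≠ [])
    {L : Set (List (Fin 3))} (hL : IsBiextendable L) {a b : Fin 3} (h : [a, b] ∈ imageLang c L) :
    (∃ x, [x] ∈ L ∧ [a, b] <:+: c x) ∨
      ∃ x y, [x, y] ∈ L ∧ (c x).getLast? = some a ∧ (c y).head? = some b := by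
  obtain ⟨V, hV, h⟩ := h
  rcases pair_infix_subApply hc h with ⟨x, hx, h'⟩ | ⟨x, y, hx, h'⟩
  · obtain ⟨s, t, rfl⟩ := List.append_of_mem hx
    exact Or.inl ⟨x, hL.infix_mem hV ⟨s, t, by simp⟩, h'⟩
  · exact Or.inr ⟨x, y, hL.infix_mem hV hx, h'⟩

/-! ### Extension graphs of images under `c1` -/

theorem isMarked_c1 : IsMarked c1 (fun a => a ≠ 2) := by
  intro a
  fin_cases a
  · exact ⟨0, [], rfl, by decide, by simp⟩
  · exact ⟨0, [2], rfl, by decide, by simp⟩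
  · exact ⟨1, [], rfl, by decide, by simp⟩

theorem c1_injective : Function.Injective c1 := by decide

/-- The square of `c1`. -/
def c1Sq : Fin 3 → List (Fin 3) := ![[0], [0, 1], [0, 2]]

theorem subApply_c1_c1 : (fun a => subApply c1 (c1 a)) = c1Sq := by
  funext a
  fin_cases a <;> rfl

theorem isMarked_c1Sq : IsMarked c1Sq (fun a => a = 0) := by
  intro a
  fin_cases a
  · exact ⟨0, [], rfl, by decide, by simp⟩
  · exact ⟨0, [1], rfl, by decide, by simp⟩
  · exact ⟨0, [2], rfl, by decide, by simp⟩

theorem c1Sq_injective : Function.Injective c1Sq := by decide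

theorem IsMarked.ne_nil {c : Fin 3 → List (Fin 3)} {B : Fin 3 → Prop} (hc : IsMarked c B)
    (a : Fin 3) : c a ≠ [] := by
  obtain ⟨h, t, ha, -⟩ := hc a
  simp [ha]

theorem getLast?_c1Sq : ∀ {a b : Fin 3}, (c1Sq a).getLast? = some b → a = b := by decide

theorem getLast?_c1 : ∀ {a b : Fin 3}, (c1 a).getLast? = some b → a = ExtGraph.swapLast b := by
  decide

theorem head?_c1 : ∀ {a b : Fin 3}, (c1 a).head? = some b → b ≠ 2 := by
  decide

theorem pair_mem_imageLang_c1 {L : Set (List (Fin 3))} (hL : IsBiextendable L) {a b : Fin 3} :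
    [a, b] ∈ imageLang c1 L ↔ (a = 0 ∧ b = 2 ∧ [1] ∈ L) ∨
      ∃ y, [ExtGraph.swapLast a, y] ∈ L ∧ (c1 y).head? = some b := by
  constructor
  · intro h
    rcases pair_mem_imageLang isMarked_c1.ne_nil hL h with ⟨x, hx, h'⟩ | ⟨x, y, hx, h1, h2⟩
    · left
      have key : ∀ x a b : Fin 3, [a, b] <:+: c1 x → a = 0 ∧ b = 2 ∧ x = 1 := by decide
      obtain ⟨rfl, rfl, rfl⟩ := key x a b h'
      exact ⟨rfl, rfl, hx⟩
    · right
      exact ⟨y, getLast?_c1 h1 ▸ hx, h2⟩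
  · rintro (⟨rfl, rfl, h⟩ | ⟨y, hy, h⟩)
    · exact ⟨_, h, List.infix_refl _⟩
    · refine ⟨_, hy, ?_⟩
      rw [subApply_cons, subApply_singleton]
      revert h
      clear hy
      revert a b y
      decide

open Classical in
theorem extGraph_nil_imageLang_c1 {L : Set (List (Fin 3))} (hL : IsBiextendable L) :
    extGraph (imageLang c1 L) [] = (extGraph L []).step1 (decide ([1] ∈ L)) := by
  apply ExtGraph.ext_adj
  intro a b
  rw [extGraph_adj, List.nil_append, pair_mem_imageLang_c1 hL, ExtGraph.adj_step1,
    ExtGraph.adj_merge]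
  have h : ∀ y, [ExtGraph.swapLast a, y] ∈ L ↔
      (extGraph L []).adj (ExtGraph.swapLast a) y = true := fun y => by
    rw [extGraph_adj, List.nil_append]
  simp only [h]
  generalize (extGraph L []).adj (ExtGraph.swapLast a) = f
  simp only [Fin.exists_fin_succ, c1]
  fin_cases b <;> simp [and_comm]

theorem IsMarked.head_subApply {c : Fin 3 → List (Fin 3)} {B : Fin 3 → Prop} (hc : IsMarked c B)
    (v : List (Fin 3)) : ∀ x ∈ (subApply c v).head?, B x := by
  rcases v with _ | ⟨y, v⟩
  · simp [subApply]
  · obtain ⟨h, t, hy, hb, -⟩ := hc y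
    simpa [subApply_cons, hy] using hb

theorem subApply_infix_of_mem {c : Fin 3 → List (Fin 3)} {a : Fin 3} {V v q : List (Fin 3)}
    {x : Fin 3} (ha : (c a).getLast? = some x) (hq : q <+: subApply c V) :
    x :: (subApply c v ++ q) <:+: subApply c (a :: (v ++ V)) := by
  obtain ⟨l, hl⟩ : ∃ l, c a = l ++ [x] := ⟨_, (List.dropLast_append_getLast? x ha).symm⟩
  obtain ⟨t, ht⟩ := hq
  exact ⟨l, t, by simp [subApply_cons, subApply_append, hl, ← ht]⟩

theorem extGraph_imageLang_c1Sq {L : Set (List (Fin 3))} (hL : IsBiextendable L)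
    (v : List (Fin 3)) :
    extGraph (imageLang c1Sq L) (subApply c1Sq v ++ [0]) = extGraph L v := by
  apply ExtGraph.ext_adj
  intro a b
  rw [extGraph_adj, extGraph_adj, List.append_assoc, List.singleton_append]
  constructor
  · intro h
    obtain ⟨a', v', V, hV, h1, h2, h3⟩ :=
      isMarked_c1Sq.parse hL h (isMarked_c1Sq.head_subApply v) rfl
    obtain rfl := isMarked_c1Sq.injective c1Sq_injective h1
    obtain rfl := getLast?_c1Sq h2
    rcases V with _ | ⟨y, V⟩
    · simp [subApply] at h3
    · have : y = b := by
        rw [subApply_cons] at h3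
        rcases V with _ | ⟨z, V⟩
        · rw [subApply_nil] at h3
          revert h3
          clear h hV
          revert b y
          decide
        · obtain ⟨q, t, hz, rfl, -⟩ := isMarked_c1Sq z
          rw [subApply_cons, hz] at h3
          fin_cases y <;> simp [c1Sq] at h3 <;> exact h3.symm
      subst this
      exact hL.infix_mem hV ⟨[], V, by simp⟩
  · intro h
    obtain ⟨z, hz⟩ := hL.right_mem h
    refine subApply_mem_imageLang hz ?_
    have := subApply_infix_of_mem (c := c1Sq) (a := a) (x := a) (v := v) (V := [b, z])
      (q := [0, b]) (by clear h hz; revert a; decide) (by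
        clear h hz
        revert b z
        decide)
    simpa using this

theorem pair_mem_imageLang_c1Sq {L : Set (List (Fin 3))} (hL : IsBiextendable L) {a b : Fin 3}
    (h : [a, b] ∈ imageLang c1Sq L) : a = 0 ∨ b = 0 := by
  rcases pair_mem_imageLang isMarked_c1Sq.ne_nil hL h with ⟨x, -, h'⟩ | ⟨x, y, -, -, h2⟩
  · revert h'
    clear h
    revert a b x
    decide
  · right
    clear h
    revert b y
    decide

theorem leftCount_le_one {e : ExtGraph} {p : Fin 3} (h : ∀ a b, e.adj a b = true → a = p) :
    e.leftCount ≤ 1 := by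
  revert h
  revert p
  revert e
  apply ExtGraph.forall_of_mk
  decide +kernel

theorem rightCount_le_one {e : ExtGraph} {p : Fin 3} (h : ∀ a b, e.adj a b = true → b = p) :
    e.rightCount ≤ 1 := by
  revert h
  revert p
  revert e
  apply ExtGraph.forall_of_mk
  decide +kernel

theorem leftCount_extGraph_le_one {L : Set (List (Fin 3))} (hL : IsBiextendable L) {x p : Fin 3}
    {u : List (Fin 3)} (h : ∀ a, [a, x] ∈ L → a = p) : (extGraph L (x :: u)).leftCount ≤ 1 := by
  refine leftCount_le_one (p := p) fun a b hab => h a ?_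
  exact hL.infix_mem (extGraph_adj.1 hab) ⟨[], u ++ [b], by simp⟩

theorem rightCount_extGraph_le_one {L : Set (List (Fin 3))} (hL : IsBiextendable L) {x p : Fin 3}
    {u : List (Fin 3)} (h : ∀ b, [x, b] ∈ L → b = p) :
    (extGraph L (u ++ [x])).rightCount ≤ 1 := by
  refine rightCount_le_one (p := p) fun a b hab => h b ?_
  exact hL.infix_mem (extGraph_adj.1 hab) ⟨a :: u, [], by simp⟩

theorem cases_imageLang_c1Sq {L : Set (List (Fin 3))} (hL : IsBiextendable L)
    (hM : IsBiextendable (imageLang c1Sq L)) {u : List (Fin 3)} (hu : u ∈ imageLang c1Sq L) :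
    u = [] ∨ (extGraph (imageLang c1Sq L) u).leftCount ≤ 1 ∨
      (extGraph (imageLang c1Sq L) u).rightCount ≤ 1 ∨
      ∃ v ∈ L, u = subApply c1Sq v ++ [0] := by
  rcases u with _ | ⟨x, u⟩
  · exact Or.inl rfl
  by_cases hx : x = 0
  swap
  · exact Or.inr <| Or.inl <| leftCount_extGraph_le_one hM fun a ha =>
      (pair_mem_imageLang_c1Sq hL ha).resolve_right hx
  obtain ⟨u', y, hy⟩ : ∃ u' y, x :: u = u' ++ [y] := by
    rcases List.eq_nil_or_concat (x :: u) with h | ⟨u', y, h⟩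
    · simp at h
    · exact ⟨u', y, by simpa using h⟩
  by_cases hy0 : y = 0
  swap
  · right; right; left
    rw [hy]
    exact rightCount_extGraph_le_one hM fun b hb =>
      (pair_mem_imageLang_c1Sq hL hb).resolve_left hy0
  right; right; right
  obtain ⟨a, ha⟩ := hM.left_mem hu
  rw [hy] at ha
  obtain ⟨a', v, V, hV, h1, -, -⟩ := isMarked_c1Sq.parse hL ha (by
    rcases u' with _ | ⟨z, u'⟩
    · simp
    · simp only [List.cons_append, List.cons.injEq] at hy
      simp [← hy.1, hx]) hy0
  exact ⟨v, hL.infix_mem hV ⟨[a'], V, by simp⟩, by rw [hy, h1, hy0]⟩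

/-! ### One step -/

theorem extGraph_c1_append_zero {L : Set (List (Fin 3))} (hL : IsBiextendable L)
    (hP : ∀ b, [0, b] ∈ L → b = 2) (v : List (Fin 3)) :
    extGraph (imageLang c1 L) (subApply c1 v ++ [0]) = (extGraph L v).restrict := by
  apply ExtGraph.ext_adj
  intro a b
  rw [extGraph_adj, List.append_assoc, List.singleton_append, ExtGraph.adj_restrict]
  have hs : (c1 (ExtGraph.swapLast a)).getLast? = some a := by revert a; decide
  have hE : ∀ y, (extGraph L v).adj (ExtGraph.swapLast a) y = true ↔
      ExtGraph.swapLast a :: (v ++ [y]) ∈ L := fun y => extGraph_adj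
  constructor
  · intro h
    obtain ⟨a', v', V, hV, h1, h2, h3⟩ :=
      isMarked_c1.parse hL h (isMarked_c1.head_subApply v) (by decide)
    obtain rfl := isMarked_c1.injective c1_injective h1
    obtain rfl := getLast?_c1 h2
    rcases V with _ | ⟨y, V⟩
    · simp [subApply] at h3
    · have hy : ExtGraph.swapLast a :: (v ++ [y]) ∈ L := hL.infix_mem hV ⟨[], V, by simp⟩
      rw [← hE] at hy
      rw [subApply_cons] at h3
      fin_cases y
      · rcases V with _ | ⟨z, V⟩
        · simp [c1, subApply] at h3
        · obtain rfl := hP z (hL.infix_mem hV ⟨ExtGraph.swapLast a :: v, V, by simp⟩)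
          have : b = 1 := by simpa [c1, subApply_cons] using h3
          subst this
          exact hy
      · have : b = 2 := by simpa [c1, subApply_cons] using h3
        subst this
        exact hy
      · simp [c1] at h3
  · intro h
    have h' : (b = 1 ∧ ExtGraph.swapLast a :: (v ++ [0]) ∈ L) ∨
        (b = 2 ∧ ExtGraph.swapLast a :: (v ++ [1]) ∈ L) := by
      rw [← hE, ← hE]
      fin_cases b
      · simp at h
      · exact Or.inl ⟨rfl, h⟩
      · exact Or.inr ⟨rfl, h⟩
    clear h
    rcases h' with ⟨rfl, h⟩ | ⟨rfl, h⟩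
    · obtain ⟨z, hz⟩ := hL.right_mem h
      obtain rfl := hP z (hL.infix_mem hz ⟨ExtGraph.swapLast a :: v, [], by simp⟩)
      refine subApply_mem_imageLang hz ?_
      simpa using subApply_infix_of_mem (v := v) (V := [0, 2]) (q := [0, 1]) hs (by decide)
    · refine subApply_mem_imageLang h ?_
      simpa using subApply_infix_of_mem (v := v) (V := [1]) (q := [0, 2]) hs (by decide)

theorem adj_extGraph_c1 {L : Set (List (Fin 3))} (hL : IsBiextendable L) (v : List (Fin 3))
    (a : Fin 3) {b : Fin 3} (hb : b ≠ 2) :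
    (extGraph (imageLang c1 L) (subApply c1 v)).adj a b = true ↔
      (extGraph L v).merge.adj a b = true := by
  have hs : (c1 (ExtGraph.swapLast a)).getLast? = some a := by revert a; decide
  have hE : (extGraph L v).merge.adj a b = true ↔
      ∃ y, (c1 y).head? = some b ∧ ExtGraph.swapLast a :: (v ++ [y]) ∈ L := by
    simp only [← extGraph_adj]
    rw [ExtGraph.adj_merge, Fin.exists_fin_succ, Fin.exists_fin_succ]
    fin_cases b
    · simp [c1]
    · simp [c1]
    · simp at hb
  rw [hE, extGraph_adj]
  constructor
  · intro h
    obtain ⟨a', v', V, hV, h1, h2, h3⟩ :=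
      isMarked_c1.parse hL h (isMarked_c1.head_subApply v) hb
    obtain rfl := isMarked_c1.injective c1_injective h1
    obtain rfl := getLast?_c1 h2
    rcases V with _ | ⟨y, V⟩
    · simp [subApply] at h3
    · refine ⟨y, ?_, hL.infix_mem hV ⟨[], V, by simp⟩⟩
      obtain ⟨q, t, hy, -⟩ := isMarked_c1 y
      simp only [subApply_cons, hy, List.cons_append, List.cons_prefix_cons] at h3
      simp [hy, h3.1]
  · rintro ⟨y, hy, h⟩
    refine subApply_mem_imageLang h ?_
    refine subApply_infix_of_mem hs ?_
    rw [subApply_singleton]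
    clear h hE hb
    revert b y
    decide

theorem pair_two_mem_imageLang_c1 {L : Set (List (Fin 3))} (hL : IsBiextendable L) {a : Fin 3}
    (h : [a, 2] ∈ imageLang c1 L) : a = 0 := by
  rcases (pair_mem_imageLang_c1 hL).1 h with h | ⟨y, -, h⟩
  · exact h.1
  · exact absurd rfl (head?_c1 h)

theorem extGraph_c1 {L : Set (List (Fin 3))} (hL : IsBiextendable L)
    (hM : IsBiextendable (imageLang c1 L)) {v : List (Fin 3)} {y : Fin 3} (hy : y ≠ 0) :
    extGraph (imageLang c1 L) (subApply c1 (v ++ [y])) = (extGraph L (v ++ [y])).merge := by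
  apply ExtGraph.ext_adj
  intro a b
  by_cases hb : b = 2
  · subst hb
    have h1 : (extGraph L (v ++ [y])).merge.adj a 2 = false := by
      rw [ExtGraph.adj_merge]
      rfl
    rw [h1, extGraph_adj]
    refine iff_of_false (fun h => ?_) (by simp)
    obtain ⟨l, z, hz, hz0⟩ : ∃ l z, c1 y = l ++ [z] ∧ z ≠ 0 := by
      fin_cases y
      · simp at hy
      · exact ⟨[0], 2, rfl, by decide⟩
      · exact ⟨[], 1, rfl, by decide⟩
    refine hz0 (pair_two_mem_imageLang_c1 hL
      (hM.infix_mem h ⟨a :: subApply c1 v ++ l, [], ?_⟩))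
    simp [subApply_append, subApply_singleton, hz]
  · exact adj_extGraph_c1 hL _ a hb

theorem cases_imageLang_c1 {L : Set (List (Fin 3))} (hL : IsBiextendable L)
    (hM : IsBiextendable (imageLang c1 L)) {u : List (Fin 3)} (hu : u ∈ imageLang c1 L) :
    u = [] ∨ (extGraph (imageLang c1 L) u).leftCount ≤ 1 ∨
      (∃ v ∈ L, u = subApply c1 v ++ [0]) ∨
      ∃ v y, v ++ [y] ∈ L ∧ y ≠ 0 ∧ u = subApply c1 (v ++ [y]) := by
  rcases u with _ | ⟨x, u⟩
  · exact Or.inl rfl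
  by_cases hx : x = 2
  · subst hx
    exact Or.inr <| Or.inl <| leftCount_extGraph_le_one hM fun a ha =>
      pair_two_mem_imageLang_c1 hL ha
  right; right
  obtain ⟨u', y, hy⟩ : ∃ u' y, x :: u = u' ++ [y] := by
    rcases List.eq_nil_or_concat (x :: u) with h | ⟨u', y, h⟩
    · simp at h
    · exact ⟨u', y, by simpa using h⟩
  obtain ⟨a, b, hab⟩ := hM.both_mem hu
  by_cases hy0 : y = 0
  · left
    rw [hy, List.append_assoc] at hab
    obtain ⟨a', v, V, hV, h1, -, -⟩ := isMarked_c1.parse hL hab (by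
      rcases u' with _ | ⟨z, u'⟩
      · simp
      · simp only [List.cons_append, List.cons.injEq] at hy
        simp [← hy.1, hx]) (by simp [hy0])
    exact ⟨v, hL.infix_mem hV ⟨[a'], V, by simp⟩, by rw [hy, h1, hy0]⟩
  · right
    have hb : b ≠ 2 := by
      rintro rfl
      refine hy0 (pair_two_mem_imageLang_c1 hL (hM.infix_mem hab ⟨a :: u', [], ?_⟩))
      simp [hy]
    obtain ⟨a', v, V, hV, h1, -, -⟩ := isMarked_c1.parse hL hab (by simpa using hx) hb
    rcases List.eq_nil_or_concat v with rfl | ⟨v, z, rfl⟩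
    · simp [subApply] at h1
    · rw [List.concat_eq_append] at hV h1
      refine ⟨v, z, hL.infix_mem hV ⟨[a'], V, by simp⟩, ?_, h1⟩
      rintro rfl
      have h3 := congrArg List.getLast? (hy.symm.trans h1)
      simp [subApply_append, subApply_singleton, c1] at h3
      exact hy0 h3

section DirectiveSequence

/-! ### The mirror symmetry -/

/-- The reversal of a word, with the letters `0` and `2` exchanged. -/
def mirrorWord (u : List (Fin 3)) : List (Fin 3) := (u.map Fin.rev).reverse

theorem mirrorWord_mirrorWord (u : List (Fin 3)) : mirrorWord (mirrorWord u) = u := by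
  simp [mirrorWord, List.map_reverse, Function.comp_def]

theorem mirrorWord_append (u v : List (Fin 3)) :
    mirrorWord (u ++ v) = mirrorWord v ++ mirrorWord u := by
  simp [mirrorWord]

theorem mirrorWord_isInfix_mirrorWord {u v : List (Fin 3)} (h : u <:+: v) :
    mirrorWord u <:+: mirrorWord v := by
  obtain ⟨s, t, rfl⟩ := h
  exact ⟨mirrorWord t, mirrorWord s, by simp [mirrorWord_append]⟩

theorem mirrorWord_cons_append (a b : Fin 3) (u : List (Fin 3)) :
    mirrorWord (a :: (u ++ [b])) = b.rev :: (mirrorWord u ++ [a.rev]) := by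
  simp [mirrorWord]

theorem mirrorWord_subApply (j : Fin 2) (u : List (Fin 3)) :
    mirrorWord (subApply (cSub j) u) = subApply (cSub j.rev) (mirrorWord u) := by
  induction u with
  | nil => rfl
  | cons a u ih =>
    have h : mirrorWord (a :: u) = mirrorWord u ++ [a.rev] := by simp [mirrorWord]
    rw [subApply_cons, mirrorWord_append, ih, h, subApply_append, subApply_singleton]
    congr 1
    fin_cases j <;> fin_cases a <;> rfl

/-- The mirror images of the words of `L`. -/
def mirrorLang (L : Set (List (Fin 3))) : Set (List (Fin 3)) := {u | mirrorWord u ∈ L}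

theorem mem_mirrorLang {L : Set (List (Fin 3))} {u : List (Fin 3)} :
    u ∈ mirrorLang L ↔ mirrorWord u ∈ L := Iff.rfl

theorem mirrorWord_mem_mirrorLang {L : Set (List (Fin 3))} {u : List (Fin 3)} :
    mirrorWord u ∈ mirrorLang L ↔ u ∈ L := by
  rw [mem_mirrorLang, mirrorWord_mirrorWord]

theorem IsBiextendable.mirrorLang {L : Set (List (Fin 3))} (hL : IsBiextendable L) :
    IsBiextendable (mirrorLang L) where
  nil_mem := hL.nil_mem
  infix_mem hv h := hL.infix_mem hv (mirrorWord_isInfix_mirrorWord h)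
  left_mem hu := by
    obtain ⟨b, hb⟩ := hL.right_mem hu
    exact ⟨b.rev, by simpa [mem_mirrorLang, mirrorWord] using hb⟩
  right_mem hu := by
    obtain ⟨b, hb⟩ := hL.left_mem hu
    exact ⟨b.rev, by simpa [mem_mirrorLang, mirrorWord] using hb⟩

theorem extGraph_mirrorLang (L : Set (List (Fin 3))) (u : List (Fin 3)) :
    extGraph (mirrorLang L) u = (extGraph L (mirrorWord u)).mirror := by
  apply ExtGraph.ext_adj
  intro a b
  rw [extGraph_adj, ExtGraph.adj_mirror, extGraph_adj, mem_mirrorLang, mirrorWord_cons_append]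

theorem mirrorLang_imageLang (j : Fin 2) (L : Set (List (Fin 3))) :
    mirrorLang (imageLang (cSub j) L) = imageLang (cSub j.rev) (mirrorLang L) := by
  ext u
  constructor
  · rintro ⟨v, hv, h⟩
    refine ⟨mirrorWord v, mirrorWord_mem_mirrorLang.2 hv, ?_⟩
    rw [← mirrorWord_subApply, ← mirrorWord_mirrorWord u]
    exact mirrorWord_isInfix_mirrorWord h
  · rintro ⟨v, hv, h⟩
    refine ⟨mirrorWord v, hv, ?_⟩
    have := mirrorWord_isInfix_mirrorWord h
    rwa [mirrorWord_subApply, Fin.rev_rev] at this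

/-! ### Chains of languages -/

/-- A sequence of biextendable languages, each being the image of the next one. -/
structure LangChain (i : ℕ → Fin 2) (L : ℕ → Set (List (Fin 3))) : Prop where
  biext : ∀ n, IsBiextendable (L n)
  image : ∀ n, L n = imageLang (cSub (i n)) (L (n + 1))

variable {i : ℕ → Fin 2} {L : ℕ → Set (List (Fin 3))}

theorem LangChain.mirror (h : LangChain i L) :
    LangChain (fun n => (i n).rev) (fun n => mirrorLang (L n)) where
  biext n := (h.biext n).mirrorLang
  image n := by
    rw [h.image n, mirrorLang_imageLang]

theorem LangChain.shift (h : LangChain i L) (k : ℕ) :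
    LangChain (fun n => i (k + n)) (fun n => L (k + n)) where
  biext n := h.biext (k + n)
  image n := h.image (k + n)

theorem one_le_edgeCount {L : Set (List (Fin 3))} (hL : IsBiextendable L) {u : List (Fin 3)}
    (hu : u ∈ L) : 1 ≤ (extGraph L u).edgeCount := by
  obtain ⟨a, b, h⟩ := hL.both_mem hu
  rw [← extGraph_adj] at h
  revert h
  generalize extGraph L u = e
  revert a b
  revert e
  apply ExtGraph.forall_of_mk
  decide +kernel

theorem mem_of_one_le_edgeCount {L : Set (List (Fin 3))} (hL : IsBiextendable L)
    {u : List (Fin 3)} (h : 1 ≤ (extGraph L u).edgeCount) : u ∈ L := by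
  have h' : ∃ a b, (extGraph L u).adj a b = true := by
    revert h
    generalize extGraph L u = e
    revert e
    apply ExtGraph.forall_of_mk
    decide +kernel
  obtain ⟨a, b, h⟩ := h'
  exact hL.infix_mem (extGraph_adj.1 h) ⟨[a], [b], rfl⟩

open Classical in
theorem LangChain.extGraph_nil (h : LangChain i L) (n : ℕ) : extGraph (L n) [] =
    (extGraph (L (n + 1)) []).step (i n) (decide ([1] ∈ L (n + 1))) := by
  have aux : ∀ {i : ℕ → Fin 2} {L : ℕ → Set (List (Fin 3))}, LangChain i L → ∀ n, i n = 0 →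
      extGraph (L n) [] = (extGraph (L (n + 1)) []).step (i n) (decide ([1] ∈ L (n + 1))) := by
    intro i L h n hn
    have := h.image n
    rw [hn] at this ⊢
    rw [this]
    exact extGraph_nil_imageLang_c1 (h.biext _)
  rcases Fin.exists_fin_two.1 ⟨i n, rfl⟩ with hn | hn
  · exact aux h n hn
  · have := aux h.mirror n (by simp [hn])
    simp only [extGraph_mirrorLang] at this
    have e : ∀ e e' : ExtGraph, e.mirror = e' → e = e'.mirror := by
      rintro e _ rfl
      rfl
    replace this := e _ _ this
    rw [hn] at this ⊢
    exact this

/-- All letters occur. -/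
def HasLetters (L : Set (List (Fin 3))) : Prop := ∀ a, [a] ∈ L

theorem HasLetters.counts {L : Set (List (Fin 3))} (hL : IsBiextendable L) (h : HasLetters L) :
    (extGraph L []).leftCount = 3 ∧ (extGraph L []).rightCount = 3 := by
  have h1 : ∀ a, ∃ b, (extGraph L []).adj a b = true := fun a => by
    simp only [extGraph_adj]
    exact hL.right_mem (h a)
  have h2 : ∀ b, ∃ a, (extGraph L []).adj a b = true := fun b => by
    simp only [extGraph_adj]
    exact hL.left_mem (h b)
  revert h1 h2
  generalize extGraph L [] = e
  revert e
  apply ExtGraph.forall_of_mk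
  decide +kernel

theorem LangChain.good_nil (h : LangChain i L) (n : ℕ) : (extGraph (L n) []).good = true := by
  rw [h.extGraph_nil n, h.extGraph_nil (n + 1)]
  refine ExtGraph.good_step_step _ _ (i (n + 2)) _ _ _
    (one_le_edgeCount (h.biext _) (h.biext _).nil_mem) ?_
  rw [h.extGraph_nil (n + 2)]
  exact ExtGraph.stepRange_step _ _ _

open Classical in
theorem LangChain.neutral_nil (h : LangChain i L) (hl : ∀ n, HasLetters (L n)) (n : ℕ) :
    (extGraph (L n) []).neutral = true := by
  rw [h.extGraph_nil n, h.extGraph_nil (n + 1), decide_eq_true (hl _ _), decide_eq_true (hl _ _)]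
  refine ExtGraph.neutral_step_step _ _ (i (n + 2)) _ ?_
  rw [h.extGraph_nil (n + 2), decide_eq_true (hl _ _)]
  exact ExtGraph.fullRange_step _ _ ((hl _).counts (h.biext _)).1 ((hl _).counts (h.biext _)).2

/-! ### Propagation -/

/-- A good graph which is neutral if `s` holds. -/
def WellFormed (s : Prop) (e : ExtGraph) : Prop := e.good = true ∧ (s → e.neutral = true)

theorem WellFormed.mirror_iff {s : Prop} {e : ExtGraph} :
    WellFormed s e.mirror ↔ WellFormed s e := by
  rw [WellFormed, WellFormed, ExtGraph.good_mirror, ExtGraph.neutral_mirror]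

/-- A weight on words that decreases under desubstitution. -/
def weight (j : Fin 2) (u : List (Fin 3)) : ℕ :=
  (u.map ((![![3, 4, 2], ![2, 4, 3]] : Fin 2 → Fin 3 → ℕ) j)).sum

theorem weight_append (j : Fin 2) (u v : List (Fin 3)) :
    weight j (u ++ v) = weight j u + weight j v := by simp [weight]

theorem weight_cons (j : Fin 2) (a : Fin 3) (v : List (Fin 3)) :
    weight j (a :: v) = weight j [a] + weight j v := by simp [weight]

theorem weight_mirrorWord (j : Fin 2) (u : List (Fin 3)) :
    weight j (mirrorWord u) = weight j.rev u := by
  induction u with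
  | nil => rfl
  | cons a u ih =>
    have h : mirrorWord (a :: u) = mirrorWord u ++ [a.rev] := by simp [mirrorWord]
    rw [h, weight_append, weight_cons, ih, add_comm]
    congr 1
    clear ih h
    revert j a
    decide

theorem weight_c1Sq (j : Fin 2) (v : List (Fin 3)) : weight j v ≤ weight 0 (subApply c1Sq v) := by
  induction v with
  | nil => rfl
  | cons a v ih =>
    rw [weight_cons, subApply_cons, weight_append]
    refine add_le_add ?_ ih
    clear ih
    revert j a
    decide

theorem weight_c1 (v : List (Fin 3)) : weight 1 v + v.length ≤ weight 0 (subApply c1 v) := by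
  induction v with
  | nil => rfl
  | cons a v ih =>
    rw [weight_cons, subApply_cons, weight_append, List.length_cons]
    have : weight 1 [a] + 1 ≤ weight 0 (c1 a) := by
      clear ih
      revert a
      decide
    omega

theorem LangChain.eq_imageLang_c1Sq (h : LangChain i L) (h0 : i 0 = 0) (h1 : i 1 = 0) :
    L 0 = imageLang c1Sq (L 2) := by
  have e1 := h.image 1
  have e0 := h.image 0
  rw [h1] at e1
  rw [h0, zero_add, e1, imageLang_imageLang] at e0
  rw [e0, ← subApply_c1_c1]
  rfl

theorem LangChain.eq_imageLang_c1 (h : LangChain i L) (h0 : i 0 = 0) :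
    L 0 = imageLang c1 (L 1) := by
  have e0 := h.image 0
  rwa [h0, zero_add] at e0

theorem LangChain.eq_two_of_pair (h : LangChain i L) (h1 : i 1 = 1) {b : Fin 3}
    (hb : [0, b] ∈ L 1) : b = 2 := by
  have e1 := h.image 1
  rw [h1] at e1
  rw [e1] at hb
  rcases pair_mem_imageLang (c := cSub 1) (by decide) (h.biext 2) hb with
    ⟨x, -, h'⟩ | ⟨x, y, -, h', -⟩
  · clear hb
    revert h'
    revert b x
    decide
  · clear hb
    revert h'
    revert b x
    decide

theorem LangChain.wellFormed_step (h : LangChain i L) (s : Prop) {u : List (Fin 3)} (hu : u ∈ L 0) :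
    u = [] ∨ WellFormed s (extGraph (L 0) u) ∨ ∃ k, ∃ v ∈ L k, weight (i k) v < weight (i 0) u ∧
      (WellFormed s (extGraph (L k) v) → WellFormed s (extGraph (L 0) u)) := by
  have aux : ∀ {i : ℕ → Fin 2} {L : ℕ → Set (List (Fin 3))}, LangChain i L → i 0 = 0 → ∀ {u},
      u ∈ L 0 → u = [] ∨ WellFormed s (extGraph (L 0) u) ∨
      ∃ k, ∃ v ∈ L k, weight (i k) v < weight (i 0) u ∧
      (WellFormed s (extGraph (L k) v) → WellFormed s (extGraph (L 0) u)) := by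
    intro i L h h0 u hu
    have hedge := one_le_edgeCount (h.biext 0) hu
    have hM := h.biext 0
    rcases Fin.exists_fin_two.1 ⟨i 1, rfl⟩ with h1 | h1
    · have e := h.eq_imageLang_c1Sq h0 h1
      rw [e] at hM hu hedge ⊢
      rcases cases_imageLang_c1Sq (h.biext 2) hM hu with rfl | hl | hl | ⟨v, hv, rfl⟩
      · exact Or.inl rfl
      · have := ExtGraph.good_of_leftCount_le _ hedge hl
        exact Or.inr (Or.inl ⟨this.1, fun _ => this.2⟩)
      · have := ExtGraph.good_of_rightCount_le _ hedge hl
        exact Or.inr (Or.inl ⟨this.1, fun _ => this.2⟩)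
      · refine Or.inr (Or.inr ⟨2, v, hv, ?_, ?_⟩)
        · rw [h0, weight_append]
          have := weight_c1Sq (i 2) v
          have : 0 < weight 0 [0] := by decide
          omega
        · rw [extGraph_imageLang_c1Sq (h.biext 2)]
          exact id
    · have hP : ∀ b, [0, b] ∈ L 1 → b = 2 := fun b => h.eq_two_of_pair h1
      have e := h.eq_imageLang_c1 h0
      rw [e] at hM hu hedge ⊢
      rcases cases_imageLang_c1 (h.biext 1) hM hu with rfl | hl | ⟨v, hv, rfl⟩ | ⟨v, y, hv, hy, rfl⟩
      · exact Or.inl rfl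
      · have := ExtGraph.good_of_leftCount_le _ hedge hl
        exact Or.inr (Or.inl ⟨this.1, fun _ => this.2⟩)
      · refine Or.inr (Or.inr ⟨1, v, hv, ?_, ?_⟩)
        · rw [h0, h1, weight_append]
          have := weight_c1 v
          have : 0 < weight 0 [0] := by decide
          omega
        · rw [extGraph_c1_append_zero (h.biext 1) hP] at hedge ⊢
          exact fun hw => ⟨ExtGraph.good_restrict _ hw.1 hedge,
            fun hs => ExtGraph.neutral_restrict _ hw.1 (hw.2 hs) hedge⟩
      · refine Or.inr (Or.inr ⟨1, v ++ [y], hv, ?_, ?_⟩)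
        · rw [h0, h1]
          have := weight_c1 (v ++ [y])
          rw [List.length_append, List.length_singleton] at this
          omega
        · rw [extGraph_c1 (h.biext 1) hM hy]
          exact fun hw => ⟨ExtGraph.good_merge _ hw.1,
            fun hs => ExtGraph.neutral_merge _ hw.1 (hw.2 hs)⟩
  rcases Fin.exists_fin_two.1 ⟨i 0, rfl⟩ with h0 | h0
  · exact aux h h0 hu
  · have := aux h.mirror (by simp [h0]) (mirrorWord_mem_mirrorLang.2 hu)
    simp only [extGraph_mirrorLang, WellFormed.mirror_iff, mirrorWord_mirrorWord] at this
    rcases this with hnil | hw | ⟨k, v, hv, hlt, hw⟩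
    · left
      rw [← mirrorWord_mirrorWord u, hnil]
      rfl
    · exact Or.inr (Or.inl hw)
    · refine Or.inr (Or.inr ⟨k, mirrorWord v, hv, ?_, hw⟩)
      rw [weight_mirrorWord, Fin.rev_rev] at hlt
      rwa [weight_mirrorWord]

theorem LangChain.wellFormed (h : LangChain i L) {s : Prop}
    (hnil : ∀ n, WellFormed s (extGraph (L n) [])) (n : ℕ) {u : List (Fin 3)} (hu : u ∈ L n) :
    WellFormed s (extGraph (L n) u) := by
  induction hm : weight (i n) u using Nat.strong_induction_on generalizing n u with
  | _ m ih =>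
    rcases (h.shift n).wellFormed_step s (u := u) hu with rfl | hw | ⟨k, v, hv, hlt, hw⟩
    · exact hnil n
    · exact hw
    · exact hw (ih _ (hm ▸ hlt) (n + k) hv rfl)

theorem LangChain.good (h : LangChain i L) (n : ℕ) {u : List (Fin 3)} (hu : u ∈ L n) :
    (extGraph (L n) u).good = true :=
  (h.wellFormed (s := False) (fun n => ⟨h.good_nil n, False.elim⟩) n hu).1

theorem LangChain.neutral (h : LangChain i L) (hl : ∀ n, HasLetters (L n)) (n : ℕ)
    {u : List (Fin 3)} (hu : u ∈ L n) : (extGraph (L n) u).neutral = true :=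
  (h.wellFormed (s := True) (fun n => ⟨h.good_nil n, fun _ => h.neutral_nil hl n⟩) n hu).2 trivial

/-! ### Defects -/

/-- Some letter is missing or some word is not neutral. -/
def Defective (L : Set (List (Fin 3))) : Prop :=
  (∃ a, [a] ∉ L) ∨ ∃ u ∈ L, (extGraph L u).neutral = false

theorem Defective.mirrorLang {L : Set (List (Fin 3))} (h : Defective L) :
    Defective (mirrorLang L) := by
  rcases h with ⟨a, ha⟩ | ⟨u, hu, h⟩
  · exact Or.inl ⟨a.rev, by simpa [mem_mirrorLang, mirrorWord] using ha⟩
  · refine Or.inr ⟨mirrorWord u, mirrorWord_mem_mirrorLang.2 hu, ?_⟩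
    rwa [extGraph_mirrorLang, mirrorWord_mirrorWord, ExtGraph.neutral_mirror]

theorem mirrorLang_mirrorLang (L : Set (List (Fin 3))) : mirrorLang (mirrorLang L) = L := by
  ext u
  rw [mem_mirrorLang, mirrorWord_mem_mirrorLang]

theorem singleton_mem_imageLang {c : Fin 3 → List (Fin 3)} {L : Set (List (Fin 3))}
    (hL : IsBiextendable L) {a : Fin 3} :
    [a] ∈ imageLang c L ↔ ∃ x, [x] ∈ L ∧ a ∈ c x := by
  constructor
  · rintro ⟨v, hv, h⟩
    have ha : a ∈ subApply c v := h.subset (by simp)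
    obtain ⟨x, hx, hxa⟩ := List.mem_flatMap.1 ha
    obtain ⟨s, t, rfl⟩ := List.append_of_mem hx
    exact ⟨x, hL.infix_mem hv ⟨s, t, by simp⟩, hxa⟩
  · rintro ⟨x, hx, ha⟩
    refine ⟨_, hx, ?_⟩
    rw [subApply_singleton]
    obtain ⟨s, t, h⟩ := List.append_of_mem ha
    exact ⟨s, t, by simp [h]⟩

theorem adj_nil_eq_false {L : Set (List (Fin 3))} {a b : Fin 3} (h : [a, b] ∉ L) :
    (extGraph L []).adj a b = false := by
  rwa [← Bool.not_eq_true, extGraph_adj]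

open Classical in
theorem LangChain.defective_zero (h : LangChain i L) (d1 : Defective (L 1)) (d2 : Defective (L 2)) :
    Defective (L 0) := by
  have aux : ∀ {i : ℕ → Fin 2} {L : ℕ → Set (List (Fin 3))}, LangChain i L → i 0 = 0 →
      Defective (L 1) → Defective (L 2) → Defective (L 0) := by
    intro i L h h0 d1 d2
    by_cases hm : HasLetters (L 0)
    swap
    · exact Or.inl (by simpa [HasLetters] using hm)
    have hM := h.biext 0
    have hcount := hm.counts hM
    have hgood := h.good_nil 0
    rcases Fin.exists_fin_two.1 ⟨i 1, rfl⟩ with h1 | h1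
    · have e := h.eq_imageLang_c1Sq h0 h1
      rw [e] at hM hm hcount hgood ⊢
      have hl : ∀ x : Fin 3, x ≠ 0 → [x] ∈ L 2 := fun x hx => by
        obtain ⟨y, hy, h'⟩ := (singleton_mem_imageLang (h.biext 2)).1 (hm x)
        have key : ∀ x y : Fin 3, x ≠ 0 → x ∈ c1Sq y → y = x := by decide
        rwa [key x y hx h'] at hy
      rcases d2 with ⟨a, ha⟩ | ⟨v, hv, hn⟩
      · by_cases ha0 : a = 0
        swap
        · exact absurd (hl a ha0) ha
        subst ha0
        refine Or.inr ⟨[], hM.nil_mem, ExtGraph.not_neutral_of_missing' _ hgood hcount.1 hcount.2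
          (adj_nil_eq_false (a := 0) (b := 0) fun h' => ?_)
          (adj_nil_eq_false (a := 1) (b := 1) fun h' => ?_)
          (adj_nil_eq_false (a := 1) (b := 2) fun h' => ?_)
          (adj_nil_eq_false (a := 2) (b := 1) fun h' => ?_)
          (adj_nil_eq_false (a := 2) (b := 2) fun h' => ?_)⟩
        · rcases pair_mem_imageLang isMarked_c1Sq.ne_nil (h.biext 2) h' with
            ⟨x, -, h'⟩ | ⟨x, y, hx, h2, -⟩
          · revert h'
            revert x
            decide
          · obtain rfl := getLast?_c1Sq h2
            exact ha ((h.biext 2).infix_mem hx ⟨[], [y], rfl⟩)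
        all_goals exact absurd (pair_mem_imageLang_c1Sq (h.biext 2) h') (by decide)
      · rw [← extGraph_imageLang_c1Sq (h.biext 2)] at hn
        refine Or.inr ⟨_, mem_of_one_le_edgeCount hM ?_, hn⟩
        rw [extGraph_imageLang_c1Sq (h.biext 2)]
        exact one_le_edgeCount (h.biext 2) hv
    · have hP : ∀ b, [0, b] ∈ L 1 → b = 2 := fun b => h.eq_two_of_pair h1
      have e := h.eq_imageLang_c1 h0
      rw [e] at hM hm hcount hgood ⊢
      have hl1 : [1] ∈ L 1 := by
        obtain ⟨y, hy, h'⟩ := (singleton_mem_imageLang (h.biext 1)).1 (hm 2)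
        have key : ∀ y : Fin 3, 2 ∈ c1 y → y = 1 := by decide
        rwa [key y h'] at hy
      have hl2 : [2] ∈ L 1 := by
        obtain ⟨y, hy, h'⟩ := (singleton_mem_imageLang (h.biext 1)).1 (hm 1)
        have key : ∀ y : Fin 3, 1 ∈ c1 y → y = 2 := by decide
        rwa [key y h'] at hy
      by_cases hl0 : [0] ∈ L 1
      swap
      · have key : ∀ b, [0, b] ∈ imageLang c1 (L 1) → b = 2 := fun b hb => by
          rcases (pair_mem_imageLang_c1 (h.biext 1)).1 hb with hb | ⟨y, hb, -⟩
          · exact hb.2.1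
          · exact absurd ((h.biext 1).infix_mem hb ⟨[], [y], rfl⟩) hl0
        refine Or.inr ⟨[], hM.nil_mem, ExtGraph.not_neutral_of_missing _ hgood hcount.1 hcount.2
          (adj_nil_eq_false (a := 0) (b := 0) fun h' => ?_)
          (adj_nil_eq_false (a := 0) (b := 1) fun h' => ?_)
          (adj_nil_eq_false (a := 1) (b := 2) fun h' => ?_)
          (adj_nil_eq_false (a := 2) (b := 2) fun h' => ?_)⟩
        · exact absurd (key _ h') (by decide)
        · exact absurd (key _ h') (by decide)
        · exact absurd (pair_two_mem_imageLang_c1 (h.biext 1) h') (by decide)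
        · exact absurd (pair_two_mem_imageLang_c1 (h.biext 1) h') (by decide)
      rcases d1 with ⟨a, ha⟩ | ⟨v, hv, hn⟩
      · fin_cases a
        · exact absurd hl0 ha
        · exact absurd hl1 ha
        · exact absurd hl2 ha
      by_contra hD
      have hD' : ∀ u ∈ imageLang c1 (L 1),
          (extGraph (imageLang c1 (L 1)) u).neutral = true := fun u hu => by
        by_contra hu'
        exact hD (Or.inr ⟨u, hu, by simpa using hu'⟩)
      have hvgood := h.good 1 hv
      refine absurd (ExtGraph.neutral_of_merge_of_restrict _ hvgood ?_ ?_) (by simp [hn])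
      · rcases List.eq_nil_or_concat v with rfl | ⟨v, y, rfl⟩
        · refine ExtGraph.neutral_merge_of_step1 _ hvgood ?_ ?_
          · obtain ⟨b, hb⟩ := (h.biext 1).right_mem hl0
            replace hb : (extGraph (L 1) []).adj 0 b = true := extGraph_adj.2 hb
            simp only [Bool.or_eq_true]
            fin_cases b
            · exact Or.inl (Or.inl hb)
            · exact Or.inl (Or.inr hb)
            · exact Or.inr hb
          · have := hD' [] hM.nil_mem
            rwa [extGraph_nil_imageLang_c1 (h.biext 1), decide_eq_true hl1] at this
        · rw [List.concat_eq_append] at *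
          by_cases hy : y = 0
          · subst hy
            have := ExtGraph.good_of_rightCount_le _ (one_le_edgeCount (h.biext 1) hv)
              (rightCount_extGraph_le_one (h.biext 1) (p := 2) hP)
            simp [this.2] at hn
          · rw [← extGraph_c1 (h.biext 1) hM hy]
            exact hD' _ (subApply_mem_imageLang hv (List.infix_refl _))
      · rw [← extGraph_c1_append_zero (h.biext 1) hP]
        exact fun h' => hD' _ (mem_of_one_le_edgeCount hM h')
  rcases Fin.exists_fin_two.1 ⟨i 0, rfl⟩ with h0 | h0
  · exact aux h h0 d1 d2
  · have := aux h.mirror (by simp [h0]) d1.mirrorLang d2.mirrorLang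
    rw [← mirrorLang_mirrorLang (L 0)]
    exact this.mirrorLang

theorem LangChain.defective (h : LangChain i L) {N : ℕ} (d : Defective (L N))
    (d' : Defective (L (N + 1))) : Defective (L 0) := by
  have key : ∀ n, n ≤ N → Defective (L (N - n)) ∧ Defective (L (N - n + 1)) := by
    intro n hn
    induction n with
    | zero => exact ⟨d, d'⟩
    | succ n ih =>
      obtain ⟨h1, h2⟩ := ih (by omega)
      have e : N - n = N - (n + 1) + 1 := by omega
      rw [e] at h1 h2
      exact ⟨(h.shift (N - (n + 1))).defective_zero h1 h2, h1⟩
  have := (key N le_rfl).1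
  rwa [Nat.sub_self] at this

/-! ### Counting words -/

theorem isInfix_dropLast (w : List (Fin 3)) : w.dropLast <:+: w :=
  ⟨[], w.drop (w.length - 1), by simp [List.dropLast_eq_take]⟩

open Classical in
/-- The words of length `n` of a language. -/
def words (L : Set (List (Fin 3))) (n : ℕ) : Finset (List (Fin 3)) :=
  (List.finite_length_eq (Fin 3) n).toFinset.filter (· ∈ L)

theorem mem_words {L : Set (List (Fin 3))} {n : ℕ} {u : List (Fin 3)} :
    u ∈ words L n ↔ u.length = n ∧ u ∈ L := by
  simp [words]

theorem ExtGraph.rightCount_eq_card : ∀ e : ExtGraph,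
    e.rightCount = (Finset.univ.filter fun b => ∃ a, e.adj a b = true).card := by
  apply ExtGraph.forall_of_mk; decide +kernel

theorem ExtGraph.leftCount_eq_card : ∀ e : ExtGraph,
    e.leftCount = (Finset.univ.filter fun a => ∃ b, e.adj a b = true).card := by
  apply ExtGraph.forall_of_mk; decide +kernel

theorem ExtGraph.edgeCount_eq_card : ∀ e : ExtGraph,
    e.edgeCount = (Finset.univ.filter fun p : Fin 3 × Fin 3 => e.adj p.1 p.2 = true).card := by
  apply ExtGraph.forall_of_mk; decide +kernel

theorem card_words_right {L : Set (List (Fin 3))} (hL : IsBiextendable L) (n : ℕ) :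
    (words L (n + 1)).card = ∑ u ∈ words L n, (extGraph L u).rightCount := by
  rw [Finset.card_eq_sum_card_fiberwise (f := List.dropLast) (t := words L n)]
  · refine Finset.sum_congr rfl fun u hu => ?_
    rw [ExtGraph.rightCount_eq_card,
      ← Finset.card_image_of_injective (f := fun b : Fin 3 => u ++ [b]) _
        fun b b' h => by simpa using h]
    congr 1
    ext w
    obtain ⟨hn, -⟩ := mem_words.1 hu
    simp only [Finset.mem_filter, mem_words, Finset.mem_image, Finset.mem_univ, true_and,
      extGraph_adj]
    constructor
    · rintro ⟨⟨h1, h2⟩, rfl⟩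
      rcases List.eq_nil_or_concat w with rfl | ⟨v, b, rfl⟩
      · simp at h1
      · rw [List.concat_eq_append, List.dropLast_concat] at *
        exact ⟨b, hL.left_mem h2, rfl⟩
    · rintro ⟨b, ⟨a, h⟩, rfl⟩
      exact ⟨⟨by simp [hn], hL.infix_mem h ⟨[a], [], by simp⟩⟩, List.dropLast_concat⟩
  · intro w hw
    obtain ⟨h1, h2⟩ := mem_words.1 hw
    exact mem_words.2 ⟨by simp [h1], hL.infix_mem h2 (isInfix_dropLast w)⟩

theorem card_words_left {L : Set (List (Fin 3))} (hL : IsBiextendable L) (n : ℕ) :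
    (words L (n + 1)).card = ∑ u ∈ words L n, (extGraph L u).leftCount := by
  rw [Finset.card_eq_sum_card_fiberwise (f := List.tail) (t := words L n)]
  · refine Finset.sum_congr rfl fun u hu => ?_
    rw [ExtGraph.leftCount_eq_card,
      ← Finset.card_image_of_injective (f := fun a : Fin 3 => a :: u) _
        fun a a' h => by simpa using h]
    congr 1
    ext w
    obtain ⟨hn, -⟩ := mem_words.1 hu
    simp only [Finset.mem_filter, mem_words, Finset.mem_image, Finset.mem_univ, true_and,
      extGraph_adj]
    constructor
    · rintro ⟨⟨h1, h2⟩, rfl⟩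
      rcases w with _ | ⟨a, v⟩
      · simp at h1
      · exact ⟨a, hL.right_mem h2, rfl⟩
    · rintro ⟨a, ⟨b, h⟩, rfl⟩
      exact ⟨⟨by simp [hn], hL.infix_mem h ⟨[], [b], by simp⟩⟩, rfl⟩
  · intro w hw
    obtain ⟨h1, h2⟩ := mem_words.1 hw
    exact mem_words.2 ⟨by simp [h1], hL.infix_mem h2 (List.tail_suffix w).isInfix⟩

theorem card_words_both {L : Set (List (Fin 3))} (hL : IsBiextendable L) (n : ℕ) :
    (words L (n + 2)).card = ∑ u ∈ words L n, (extGraph L u).edgeCount := by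
  rw [Finset.card_eq_sum_card_fiberwise (f := fun w => w.tail.dropLast) (t := words L n)]
  · refine Finset.sum_congr rfl fun u hu => ?_
    rw [ExtGraph.edgeCount_eq_card,
      ← Finset.card_image_of_injective (f := fun p : Fin 3 × Fin 3 => p.1 :: (u ++ [p.2])) _
        fun p q h => by simpa [Prod.ext_iff] using h]
    congr 1
    ext w
    obtain ⟨hn, -⟩ := mem_words.1 hu
    simp only [Finset.mem_filter, mem_words, Finset.mem_image, Finset.mem_univ, true_and,
      extGraph_adj, Prod.exists]
    constructor
    · rintro ⟨⟨h1, h2⟩, rfl⟩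
      rcases w with _ | ⟨a, v⟩
      · simp at h1
      rcases List.eq_nil_or_concat v with rfl | ⟨v, b, rfl⟩
      · simp at h1
      · rw [List.concat_eq_append, List.tail_cons, List.dropLast_concat] at *
        exact ⟨a, b, h2, rfl⟩
    · rintro ⟨a, b, h, rfl⟩
      exact ⟨⟨by simp [hn], h⟩, List.dropLast_concat⟩
  · intro w hw
    obtain ⟨h1, h2⟩ := mem_words.1 hw
    exact mem_words.2 ⟨by simp [h1], hL.infix_mem h2
      ((isInfix_dropLast _).trans (List.tail_suffix w).isInfix)⟩

theorem words_zero {L : Set (List (Fin 3))} (hL : IsBiextendable L) : words L 0 = {[]} := by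
  ext u
  simp only [mem_words, List.length_eq_zero_iff, Finset.mem_singleton, and_iff_left_iff_imp]
  rintro rfl
  exact hL.nil_mem

theorem card_words_of_neutral {L : Set (List (Fin 3))} (hL : IsBiextendable L)
    (hl : HasLetters L) (hn : ∀ u ∈ L, (extGraph L u).neutral = true) (n : ℕ) :
    (words L n).card = 2 * n + 1 := by
  induction n using Nat.twoStepInduction with
  | zero => simp [words_zero hL]
  | one => rw [card_words_right hL 0, words_zero hL, Finset.sum_singleton, (hl.counts hL).2]
  | more n h0 h1 =>
    have key : ∑ u ∈ words L n, ((extGraph L u).edgeCount + 1) =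
        ∑ u ∈ words L n, ((extGraph L u).leftCount + (extGraph L u).rightCount) :=
      Finset.sum_congr rfl fun u hu => Nat.eq_of_beq_eq_true (hn u (mem_words.1 hu).2)
    rw [Finset.sum_add_distrib, Finset.sum_add_distrib, ← card_words_both hL,
      ← card_words_left hL, ← card_words_right hL, ← Finset.card_eq_sum_ones, h0, h1] at key
    omega

theorem not_defective_of_card_words {L : Set (List (Fin 3))} (hL : IsBiextendable L)
    (hg : ∀ u ∈ L, (extGraph L u).good = true) (h : ∀ n, (words L n).card = 2 * n + 1) :
    ¬ Defective L := by
  rintro (⟨a, ha⟩ | ⟨u, hu, hn⟩)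
  · have h1 := card_words_right hL 0
    rw [words_zero hL, Finset.sum_singleton, h] at h1
    have key : ∀ e : ExtGraph, e.rightCount = 3 → ∀ b, ∃ a, e.adj a b = true := by
      apply ExtGraph.forall_of_mk
      decide +kernel
    obtain ⟨b, hb⟩ := key _ h1.symm a
    exact ha (hL.infix_mem (extGraph_adj.1 hb) ⟨[b], [], rfl⟩)
  · have key : ∑ u ∈ words L u.length, ((extGraph L u).edgeCount + 1) <
        ∑ u ∈ words L u.length, ((extGraph L u).leftCount + (extGraph L u).rightCount) := by
      refine Finset.sum_lt_sum (fun v hv => ExtGraph.good_le _ (hg v (mem_words.1 hv).2))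
        ⟨u, mem_words.2 ⟨rfl, hu⟩, lt_of_le_of_ne (ExtGraph.good_le _ (hg u hu)) fun he => ?_⟩
      rw [ExtGraph.neutral, he, Nat.beq_refl] at hn
      simp at hn
    rw [Finset.sum_add_distrib, Finset.sum_add_distrib, ← card_words_both hL,
      ← card_words_left hL, ← card_words_right hL, ← Finset.card_eq_sum_ones, h, h, h] at key
    omega

/-! ### Factors of infinite words -/

theorem win_length (x : ℕ → Fin 3) (k n : ℕ) : (win x k n).length = n := by simp [win]

theorem win_add (x : ℕ → Fin 3) (k m n : ℕ) : win x k (m + n) = win x k m ++ win x (k + m) n := by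
  simp [win, List.range_add, Function.comp_def, add_assoc]

theorem win_one (x : ℕ → Fin 3) (k : ℕ) : win x k 1 = [x k] := by simp [win]

theorem win_getElem? (x : ℕ → Fin 3) {k n j : ℕ} (h : j < n) :
    (win x k n)[j]? = some (x (k + j)) := by
  simp [win, h]

/-- The factors of an infinite word. -/
def fac (x : ℕ → Fin 3) : Set (List (Fin 3)) := {u | ∃ k n, u = win x k n}

theorem win_mem_fac (x : ℕ → Fin 3) (k n : ℕ) : win x k n ∈ fac x := ⟨k, n, rfl⟩

theorem mem_fac_iff {x : ℕ → Fin 3} {u : List (Fin 3)} :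
    u ∈ fac x ↔ ∃ n, u <:+: win x 0 n := by
  constructor
  · rintro ⟨k, n, rfl⟩
    exact ⟨k + n, win x 0 k, [], by rw [win_add, zero_add, List.append_nil]⟩
  · rintro ⟨n, s, t, h⟩
    have hn : n = s.length + u.length + t.length := by
      rw [← win_length x 0 n, ← h]
      simp [add_assoc]
    rw [hn, win_add, win_add, zero_add] at h
    have h1 := (List.append_inj h (by simp [win_length])).1
    exact ⟨_, _, (List.append_inj h1 (by simp [win_length])).2⟩

theorem mem_fac_of_infix_word {x : ℕ → Fin 3} {u v : List (Fin 3)} (hv : v ∈ fac x) (h : u <:+: v) :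
    u ∈ fac x := by
  obtain ⟨n, hn⟩ := mem_fac_iff.1 hv
  exact mem_fac_iff.2 ⟨n, h.trans hn⟩

theorem singleton_mem_fac {x : ℕ → Fin 3} {a : Fin 3} : [a] ∈ fac x ↔ ∃ k, x k = a := by
  constructor
  · rintro ⟨k, n, h⟩
    have hn : n = 1 := by simpa [win_length] using (congrArg List.length h).symm
    subst hn
    rw [win_one] at h
    exact ⟨k, by simpa using h.symm⟩
  · rintro ⟨k, rfl⟩
    exact ⟨k, 1, (win_one x k).symm⟩

theorem complexity_eq (x : ℕ → Fin 3) (n : ℕ) : complexity x n = (words (fac x) n).card := by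
  rw [complexity, ← Set.ncard_coe_finset]
  congr 1
  ext u
  simp only [Set.mem_ofPred_eq, Finset.mem_coe, mem_words]
  constructor
  · rintro ⟨k, rfl⟩
    exact ⟨win_length x k n, win_mem_fac x k n⟩
  · rintro ⟨h, k, m, rfl⟩
    rw [win_length] at h
    exact ⟨k, by rw [h]⟩

/-- The infinite word `y` is the image of `x` under `c`. -/
def IsImage (c : Fin 3 → List (Fin 3)) (x y : ℕ → Fin 3) : Prop :=
  ∀ k, subApply c (win x 0 k) = win y 0 (subApply c (win x 0 k)).length

theorem IsImage.comp {c d : Fin 3 → List (Fin 3)} {x y z : ℕ → Fin 3} (h : IsImage c x y)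
    (h' : IsImage d y z) : IsImage (fun a => subApply d (c a)) x z := by
  intro k
  rw [← subApply_subApply, h k]
  exact h' _

theorem length_le_subApply {c : Fin 3 → List (Fin 3)} (hc : ∀ a, c a ≠ []) (v : List (Fin 3)) :
    v.length ≤ (subApply c v).length := by
  induction v with
  | nil => simp
  | cons a v ih =>
    rw [subApply_cons, List.length_append, List.length_cons]
    have := List.length_pos_iff.2 (hc a)
    omega

theorem win_monotone (x : ℕ → Fin 3) (k : ℕ) {m n : ℕ} (h : m ≤ n) : win x k m <+: win x k n := by
  obtain ⟨d, rfl⟩ := Nat.exists_eq_add_of_le h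
  exact ⟨_, (win_add x k m d).symm⟩

theorem IsImage.fac_eq {c : Fin 3 → List (Fin 3)} {x y : ℕ → Fin 3} (h : IsImage c x y)
    (hc : ∀ a, c a ≠ []) : fac y = imageLang c (fac x) := by
  ext u
  constructor
  · intro hu
    obtain ⟨n, hn⟩ := mem_fac_iff.1 hu
    refine ⟨win x 0 n, win_mem_fac x 0 n, hn.trans ?_⟩
    rw [h n]
    refine (win_monotone y 0 ?_).isInfix
    have := length_le_subApply hc (win x 0 n)
    rwa [win_length] at this
  · rintro ⟨v, hv, hu⟩
    obtain ⟨n, hn⟩ := mem_fac_iff.1 hv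
    refine mem_fac_iff.2 ⟨(subApply c (win x 0 n)).length, ?_⟩
    rw [← h n]
    exact hu.trans (subApply_infix_subApply c hn)

/-! ### Composites of substitutions -/

/-- The composite of the `t` substitutions starting at level `n`. -/
def tau (i : ℕ → Fin 2) (n t : ℕ) : Fin 3 → List (Fin 3) := dirProd (fun k => cSub (i (n + k))) t

theorem tau_zero (i : ℕ → Fin 2) (n : ℕ) : tau i n 0 = fun a => [a] := rfl

theorem tau_succ (i : ℕ → Fin 2) (n t : ℕ) (a : Fin 3) :
    tau i n (t + 1) a = subApply (tau i n t) (cSub (i (n + t)) a) := rfl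

theorem subApply_id (v : List (Fin 3)) : subApply (fun a => [a]) v = v := by
  simp [subApply]

theorem tau_add (i : ℕ → Fin 2) (n s t : ℕ) (a : Fin 3) :
    tau i n (s + t) a = subApply (tau i n s) (tau i (n + s) t a) := by
  induction t generalizing a with
  | zero => rw [tau_zero, subApply_singleton, add_zero]
  | succ t ih =>
    rw [← add_assoc, tau_succ, tau_succ, subApply_subApply, add_assoc]
    exact congrArg (subApply · _) (funext ih)

theorem tau_one (i : ℕ → Fin 2) (n : ℕ) : tau i n 1 = cSub (i n) := by
  funext a
  rw [tau_succ, tau_zero, subApply_id, add_zero]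

theorem cSub_ne_nil : ∀ (j : Fin 2) (a : Fin 3), cSub j a ≠ [] := by decide

theorem tau_ne_nil (i : ℕ → Fin 2) (n t : ℕ) (a : Fin 3) : tau i n t a ≠ [] := by
  induction t generalizing a with
  | zero => simp [tau_zero]
  | succ t ih =>
    intro h
    have := length_le_subApply ih (cSub (i (n + t)) a)
    rw [tau_succ] at h
    rw [h, List.length_nil, Nat.le_zero, List.length_eq_zero_iff] at this
    exact cSub_ne_nil _ _ this

theorem length_subApply_le {c : Fin 3 → List (Fin 3)} {m : ℕ} (hc : ∀ a, (c a).length ≤ m)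
    (v : List (Fin 3)) : (subApply c v).length ≤ m * v.length := by
  induction v with
  | nil => simp [subApply]
  | cons a v ih =>
    rw [subApply_cons, List.length_append, List.length_cons, mul_add, mul_one, add_comm]
    exact add_le_add ih (hc a)

theorem exists_length_tau_le (i : ℕ → Fin 2) (n t : ℕ) : ∃ m, ∀ a, (tau i n t a).length ≤ m :=
  ⟨∑ a, (tau i n t a).length, fun a =>
    Finset.single_le_sum (f := fun a => (tau i n t a).length) (fun _ _ => Nat.zero_le _)
      (Finset.mem_univ a)⟩

theorem mem_subApply {c : Fin 3 → List (Fin 3)} {b : Fin 3} {v : List (Fin 3)} :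
    b ∈ subApply c v ↔ ∃ a ∈ v, b ∈ c a := List.mem_flatMap

/-! ### Desubstitution of a limit word -/

theorem exists_desubstitution {i : ℕ → Fin 2} {a : ℕ → Fin 3} {w : ℕ → Fin 3}
    (hw : LimitWord (fun n => cSub (i n)) a w) :
    ∃ X : ℕ → ℕ → Fin 3, X 0 = w ∧ ∀ n, IsImage (cSub (i n)) (X (n + 1)) (X n) := by
  have h0 : ∀ N, dirProd (fun n => cSub (i n)) N (a N) = tau i 0 (N - 0) (a N) := fun N => by
    simp [tau]
  simp only [LimitWord, h0] at hw
  have hlen : ∀ n k : ℕ, ∀ᶠ N in (hyperfilter ℕ : Filter ℕ),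
      k < (tau i n (N - n) (a N)).length := by
    intro n k
    obtain ⟨m, hm⟩ := exists_length_tau_le i 0 n
    obtain ⟨N₀, hN₀⟩ := hw (m * k + 1)
    refine Nat.hyperfilter_le_atTop (eventually_atTop.2 ⟨max n N₀, fun N hN => ?_⟩)
    have h1 := (hN₀ N (le_trans (le_max_right _ _) hN)).1
    obtain ⟨t, rfl⟩ := Nat.exists_eq_add_of_le (le_trans (le_max_left _ _) hN)
    rw [Nat.sub_zero, tau_add, zero_add] at h1
    have h2 := length_subApply_le hm (tau i n t (a (n + t)))
    rw [Nat.add_sub_cancel_left]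
    by_contra hlt
    have := Nat.mul_le_mul_left m (not_lt.1 hlt)
    omega
  have hex : ∀ n k : ℕ, ∃ x : Fin 3, ∀ᶠ N in (hyperfilter ℕ : Filter ℕ),
      (tau i n (N - n) (a N))[k]? = some x := by
    intro n k
    have h : ∀ᶠ N in (hyperfilter ℕ : Filter ℕ), ∃ x : Fin 3,
        (tau i n (N - n) (a N))[k]? = some x := by
      filter_upwards [hlen n k] with N hN
      exact ⟨(tau i n (N - n) (a N))[k], List.getElem?_eq_getElem hN⟩
    simp only [Fin.exists_fin_succ, Ultrafilter.eventually_or, IsEmpty.exists_iff, or_false] at h ⊢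
    simpa using h
  choose X hX using hex
  have hpre : ∀ n k : ℕ, ∀ᶠ N in (hyperfilter ℕ : Filter ℕ),
      win (X n) 0 k <+: tau i n (N - n) (a N) := by
    intro n k
    induction k with
    | zero => exact Eventually.of_forall fun N => by simp [win]
    | succ k ih =>
      filter_upwards [ih, hX n k] with N h1 h2
      obtain ⟨t, ht⟩ := h1
      rw [← ht, List.getElem?_append_right (by rw [win_length]), win_length, Nat.sub_self] at h2
      rcases t with _ | ⟨x, t⟩
      · simp at h2
      · obtain rfl : x = X n k := by simpa using h2
        exact ⟨t, by rw [← ht, win_add, win_one, zero_add]; simp⟩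
  refine ⟨X, ?_, fun n k => ?_⟩
  · funext k
    obtain ⟨N₀, hN₀⟩ := hw (k + 1)
    have h1 : ∀ᶠ N in (hyperfilter ℕ : Filter ℕ), (tau i 0 (N - 0) (a N))[k]? = some (w k) :=
      Nat.hyperfilter_le_atTop
        (eventually_atTop.2 ⟨N₀, fun N hN => (hN₀ N hN).2 k (Nat.lt_succ_self k)⟩)
    obtain ⟨N, h2, h3⟩ := ((hX 0 k).and h1).exists
    rw [h2] at h3
    exact Option.some.inj h3
  · have hge : ∀ᶠ N in (hyperfilter ℕ : Filter ℕ), n + 1 ≤ N :=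
      Nat.hyperfilter_le_atTop (eventually_ge_atTop _)
    obtain ⟨N, ⟨h1, h2⟩, h3⟩ := (((hpre (n + 1) k).and
      (hpre n (subApply (cSub (i n)) (win (X (n + 1)) 0 k)).length)).and hge).exists
    obtain ⟨t, rfl⟩ := Nat.exists_eq_add_of_le h3
    rw [Nat.add_sub_cancel_left] at h1
    have e : n + 1 + t - n = 1 + t := by omega
    rw [e, tau_add, tau_one] at h2
    obtain ⟨s, hs⟩ := h1
    have h4 : subApply (cSub (i n)) (win (X (n + 1)) 0 k) <+:
        subApply (cSub (i n)) (tau i (n + 1) t (a (n + 1 + t))) := by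
      rw [← hs, subApply_append]
      exact List.prefix_append _ _
    exact (List.prefix_of_prefix_length_le h4 h2 (by rw [win_length])).eq_of_length
      (by rw [win_length])

theorem isImage_tau {i : ℕ → Fin 2} {X : ℕ → ℕ → Fin 3}
    (hX : ∀ n, IsImage (cSub (i n)) (X (n + 1)) (X n)) (n t : ℕ) :
    IsImage (tau i n t) (X (n + t)) (X n) := by
  induction t with
  | zero =>
    intro k
    rw [tau_zero, subApply_id, win_length, add_zero]
  | succ t ih =>
    exact (hX (n + t)).comp ih

theorem fac_eq_tau {i : ℕ → Fin 2} {X : ℕ → ℕ → Fin 3}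
    (hX : ∀ n, IsImage (cSub (i n)) (X (n + 1)) (X n)) (n t : ℕ) :
    fac (X n) = imageLang (tau i n t) (fac (X (n + t))) :=
  (isImage_tau hX n t).fac_eq (tau_ne_nil i n t)

/-- Images of letters eventually contain all letters. -/
def IsMixing (i : ℕ → Fin 2) (X : ℕ → ℕ → Fin 3) : Prop :=
  ∀ n, ∃ t, ∀ a, [a] ∈ fac (X (n + t)) →
    2 ≤ (tau i n t a).length ∧ ∀ b, [b] ∈ fac (X n) → b ∈ tau i n t a

theorem IsMixing.exists_le_length {i : ℕ → Fin 2} {X : ℕ → ℕ → Fin 3}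
    (hX : ∀ n, IsImage (cSub (i n)) (X (n + 1)) (X n)) (h : IsMixing i X) (n m : ℕ) :
    ∃ t, ∀ a, [a] ∈ fac (X (n + t)) → m ≤ (tau i n t a).length := by
  induction m with
  | zero => exact ⟨0, fun _ _ => Nat.zero_le _⟩
  | succ m ih =>
    obtain ⟨s, hs⟩ := ih
    obtain ⟨t, ht⟩ := h (n + s)
    refine ⟨s + t, fun a ha => ?_⟩
    rw [← add_assoc] at ha
    rw [tau_add]
    have hsub : ∀ b ∈ tau i (n + s) t a, [b] ∈ fac (X (n + s)) := fun b hb => by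
      rw [fac_eq_tau hX (n + s) t]
      refine ⟨_, ha, ?_⟩
      rw [subApply_singleton]
      obtain ⟨u, v, huv⟩ := List.append_of_mem hb
      exact ⟨u, v, by simp [huv]⟩
    have h2 := (ht a ha).1
    generalize tau i (n + s) t a = v at hsub h2
    rcases v with _ | ⟨x, _ | ⟨y, v⟩⟩
    · simp at h2
    · simp at h2
    · rw [subApply_cons, subApply_cons, List.length_append, List.length_append]
      have h3 := hs x (hsub x (by simp))
      have h4 := List.length_pos_iff.2 (tau_ne_nil i n s y)
      omega

theorem IsMixing.isBiextendable {i : ℕ → Fin 2} {X : ℕ → ℕ → Fin 3}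
    (hX : ∀ n, IsImage (cSub (i n)) (X (n + 1)) (X n)) (h : IsMixing i X) (n : ℕ) :
    IsBiextendable (fac (X n)) where
  nil_mem := ⟨0, 0, rfl⟩
  infix_mem := mem_fac_of_infix_word
  right_mem := by
    rintro u ⟨k, m, rfl⟩
    exact ⟨X n (k + m), k, m + 1, by rw [win_add, win_one]⟩
  left_mem := by
    rintro u ⟨k, m, rfl⟩
    rcases k with _ | k
    swap
    · exact ⟨X n k, k, 1 + m, by rw [win_add, win_one]; rfl⟩
    obtain ⟨s, hs⟩ := h.exists_le_length hX n m
    obtain ⟨t, ht⟩ := h (n + s)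
    set x := X (n + s) with hx
    have hx0 : [x 0] ∈ fac x := singleton_mem_fac.2 ⟨0, rfl⟩
    have hz : ∃ z, [z, x 0] ∈ fac x := by
      set y := X (n + s + t) with hy
      have hmem := (ht (y 1) (singleton_mem_fac.2 ⟨1, rfl⟩)).2 _ hx0
      have him := isImage_tau hX (n + s) t 2
      rw [← hy, ← hx, win_add _ 0 1 1, zero_add, win_one, win_one, subApply_append,
        subApply_singleton, subApply_singleton] at him
      obtain ⟨u, v, huv⟩ := List.append_of_mem hmem
      rcases List.eq_nil_or_concat (tau i (n + s) t (y 0) ++ u) with hnil | ⟨q, z, hq⟩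
      · simp [tau_ne_nil] at hnil
      · refine ⟨z, mem_fac_iff.2 ⟨_, q, v, Eq.trans ?_ him⟩⟩
        rw [huv, ← List.append_assoc, hq]
        simp
    obtain ⟨z, hz⟩ := hz
    have hpre : win (X n) 0 m <+: tau i n s (x 0) := by
      have him := isImage_tau hX n s 1
      rw [win_one, subApply_singleton] at him
      rw [him]
      exact win_monotone _ _ (hs _ hx0)
    rcases List.eq_nil_or_concat (tau i n s z) with hnil | ⟨q, a, hq⟩
    · exact absurd hnil (tau_ne_nil i n s z)
    · refine ⟨a, ?_⟩
      rw [fac_eq_tau hX n s]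
      refine ⟨_, hz, ?_⟩
      obtain ⟨v, hv⟩ := hpre
      exact ⟨q, v, by rw [subApply_cons, subApply_singleton, hq, ← hv]; simp⟩

theorem IsMixing.langChain {i : ℕ → Fin 2} {X : ℕ → ℕ → Fin 3}
    (hX : ∀ n, IsImage (cSub (i n)) (X (n + 1)) (X n)) (h : IsMixing i X) :
    LangChain i (fun n => fac (X n)) where
  biext := h.isBiextendable hX
  image n := (hX n).fac_eq (cSub_ne_nil (i n))

/-! ### Primitive sequences -/

theorem count_subApply (c : Fin 3 → List (Fin 3)) (b : Fin 3) (v : List (Fin 3)) :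
    ((subApply c v).count b : ℝ) = ∑ x, ((c x).count b : ℝ) * (v.count x : ℝ) := by
  induction v with
  | nil => simp [subApply]
  | cons a v ih =>
    rw [subApply_cons, List.count_append, Nat.cast_add, ih]
    simp only [List.count_cons, Nat.cast_add, mul_add, Finset.sum_add_distrib]
    rw [add_comm]
    congr 1
    simp

theorem cMat_apply (j : Fin 2) (x a : Fin 3) : cMat j x a = ((cSub j a).count x : ℝ) := by
  fin_cases j <;> fin_cases x <;> fin_cases a <;> simp [cMat, C1, C2, cSub, c1, c2]

theorem segProd_apply (i : ℕ → Fin 2) (r t : ℕ) (b a : Fin 3) :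
    segProd (fun n => cMat (i n)) r (r + t) b a = ((tau i r t a).count b : ℝ) := by
  induction t generalizing a with
  | zero =>
    by_cases h : b = a
    · simp [segProd, tau_zero, h]
    · simp [segProd, tau_zero, h, Ne.symm h]
  | succ t ih =>
    have h : segProd (fun n => cMat (i n)) r (r + (t + 1)) =
        segProd (fun n => cMat (i n)) r (r + t) * cMat (i (r + t)) := by
      simp [segProd, List.range_succ]
    rw [h, Matrix.mul_apply, tau_succ, count_subApply]
    exact Finset.sum_congr rfl fun x _ => by rw [ih, cMat_apply]

theorem isPrimitiveSeq_iff (i : ℕ → Fin 2) : IsPrimitiveSeq (fun n => cMat (i n)) ↔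
    ∀ n, ∃ t, ∀ a b, b ∈ tau i n t a := by
  constructor
  · intro h n
    obtain ⟨s, hs, hpos⟩ := h n
    obtain ⟨t, rfl⟩ := Nat.exists_eq_add_of_lt hs
    refine ⟨t + 1, fun a b => ?_⟩
    have := hpos b a
    rw [add_assoc, segProd_apply] at this
    exact List.count_pos_iff.1 (by exact_mod_cast this)
  · intro h n
    obtain ⟨t, ht⟩ := h n
    refine ⟨n + t, ?_, fun b a => ?_⟩
    · rcases t with _ | t
      · exact absurd (ht 0 1) (by simp [tau_zero])
      · omega
    · rw [segProd_apply]
      exact_mod_cast List.count_pos_iff.2 (ht a b)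

theorem complexity_of_primitive {i : ℕ → Fin 2} {X : ℕ → ℕ → Fin 3}
    (hX : ∀ n, IsImage (cSub (i n)) (X (n + 1)) (X n))
    (h : ∀ n, ∃ t, ∀ a b, b ∈ tau i n t a) (n : ℕ) : complexity (X 0) n = 2 * n + 1 := by
  have hm : IsMixing i X := fun n => by
    obtain ⟨t, ht⟩ := h n
    refine ⟨t, fun a _ => ⟨?_, fun b _ => ht a b⟩⟩
    have : ([0, 1] : List (Fin 3)).Subperm (tau i n t a) :=
      List.subperm_of_subset (by decide) fun b _ => ht a b
    simpa using this.length_le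
  have hl : ∀ n, HasLetters (fac (X n)) := fun n b => by
    obtain ⟨t, ht⟩ := h n
    rw [fac_eq_tau hX n t, singleton_mem_imageLang (hm.isBiextendable hX _)]
    exact ⟨_, singleton_mem_fac.2 ⟨0, rfl⟩, ht _ b⟩
  have hc := hm.langChain hX
  rw [complexity_eq]
  exact card_words_of_neutral (hc.biext 0) (hl 0) (fun u hu => hc.neutral hl 0 hu) n

/-! ### Non-primitive sequences -/

theorem IsImage.locate {c : Fin 3 → List (Fin 3)} {x y : ℕ → Fin 3} (h : IsImage c x y)
    (hc : ∀ a, c a ≠ []) (p : ℕ) :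
    ∃ q r, p = (subApply c (win x 0 q)).length + r ∧ (c (x q))[r]? = some (y p) := by
  have key : ∀ n, p < (subApply c (win x 0 n)).length →
      ∃ q r, p = (subApply c (win x 0 q)).length + r ∧ r < (c (x q)).length := by
    intro n
    induction n with
    | zero => simp [win, subApply]
    | succ n ih =>
      intro hn
      by_cases hp : p < (subApply c (win x 0 n)).length
      · exact ih hp
      · rw [win_add, zero_add, win_one, subApply_append, subApply_singleton,
          List.length_append] at hn
        exact ⟨n, p - (subApply c (win x 0 n)).length, by omega, by omega⟩
  have hlen := length_le_subApply hc (win x 0 (p + 1))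
  rw [win_length] at hlen
  obtain ⟨q, r, hp, hr⟩ := key (p + 1) hlen
  refine ⟨q, r, hp, ?_⟩
  have h1 := h (q + 1)
  have h2 : (subApply c (win x 0 (q + 1))).length =
      (subApply c (win x 0 q)).length + (c (x q)).length := by
    rw [win_add, zero_add, win_one, subApply_append, subApply_singleton, List.length_append]
  have h3 := win_getElem? y (k := 0) (j := p) (n := (subApply c (win x 0 (q + 1))).length)
    (by omega)
  rw [← h1, zero_add, win_add, zero_add, win_one, subApply_append, subApply_singleton,
    List.getElem?_append_right (by omega)] at h3
  rwa [hp, Nat.add_sub_cancel_left, ← hp] at h3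

theorem IsImage.complexity_le {c : Fin 3 → List (Fin 3)} {x y : ℕ → Fin 3} (h : IsImage c x y)
    (hc : ∀ a, c a ≠ []) {m J : ℕ} {z : Fin 3} (hm : ∀ a, (c a).length ≤ m)
    (hJ : ∀ j, J ≤ j → x j = z) (n : ℕ) : complexity y n ≤ m * (J + 1) := by
  have hsub : {u : List (Fin 3) | ∃ k, u = win y k n} ⊆
      ((Finset.range m ×ˢ Finset.range (J + 1)).image fun s : ℕ × ℕ =>
        ((subApply c (win x s.2 (n + 1))).drop s.1).take n : Finset (List (Fin 3))) := by
    rintro u ⟨p, rfl⟩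
    obtain ⟨q, r, hp, hr⟩ := h.locate hc p
    have hr' : r < (c (x q)).length := (List.getElem?_eq_some_iff.1 hr).1
    have hq : win x (min q J) (n + 1) = win x q (n + 1) := by
      rcases le_total q J with hqJ | hqJ
      · rw [min_eq_left hqJ]
      · rw [min_eq_right hqJ]
        refine List.map_congr_left fun j _ => ?_
        rw [hJ (J + j) (by omega), hJ (q + j) (by omega)]
    simp only [Finset.coe_image, Set.mem_image, Finset.mem_coe, Finset.mem_product,
      Finset.mem_range, Prod.exists]
    refine ⟨r, min q J, ⟨lt_of_lt_of_le hr' (hm _), Nat.lt_succ_of_le (min_le_right _ _)⟩, ?_⟩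
    rw [hq]
    have h1 := h (q + (n + 1))
    rw [win_add, zero_add, subApply_append, List.length_append, win_add y] at h1
    have h2 := (List.append_inj h1 (win_length _ _ _).symm).2
    have h3 : (c (x q)).length + n ≤ (subApply c (win x q (n + 1))).length := by
      rw [add_comm n 1, win_add, win_one, subApply_append, subApply_singleton, List.length_append]
      have := length_le_subApply hc (win x (q + 1) n)
      rw [win_length] at this
      omega
    obtain ⟨s, hs⟩ := Nat.exists_eq_add_of_le
      (show r + n ≤ (subApply c (win x q (n + 1))).length by omega)
    rw [hs, zero_add, add_assoc, win_add y, win_add y] at h2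
    rw [h2, List.drop_left' (win_length _ _ _), List.take_left' (win_length _ _ _), hp]
  refine (Set.ncard_le_ncard hsub (Finset.finite_toSet _)).trans ?_
  rw [Set.ncard_coe_finset]
  refine Finset.card_image_le.trans ?_
  rw [Finset.card_product, Finset.card_range, Finset.card_range]

/-- The square of `cSub j`. -/
def cSubSq (j : Fin 2) (a : Fin 3) : List (Fin 3) := subApply (cSub j) (cSub j a)

theorem cSubSq_ne_nil : ∀ (j : Fin 2) (a : Fin 3), cSubSq j a ≠ [] := by decide

theorem length_cSubSq_le : ∀ (j : Fin 2) (a : Fin 3), (cSubSq j a).length ≤ 2 := by decide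

theorem lt_two_of_getElem?_cSubSq {j : Fin 2} {x b : Fin 3} {r : ℕ}
    (h : (cSubSq j x)[r]? = some b) : r < 2 :=
  lt_of_lt_of_le (List.getElem?_eq_some_iff.1 h).1 (length_cSubSq_le j x)

theorem getElem?_cSubSq_zero {x b : Fin 3} {r : ℕ} (h : (cSubSq 0 x)[r]? = some b) (hb : b ≠ 0) :
    r = 1 ∧ x = b := by
  have hr := lt_two_of_getElem?_cSubSq h
  have key : ∀ x b : Fin 3, ∀ r < 2, (cSubSq 0 x)[r]? = some b → b ≠ 0 → r = 1 ∧ x = b := by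
    decide
  exact key x b r hr h hb

theorem getElem?_cSubSq_one {x b : Fin 3} {r : ℕ} (h : (cSubSq 1 x)[r]? = some b) (hb : b ≠ 2) :
    r = 0 ∧ x = b := by
  have hr := lt_two_of_getElem?_cSubSq h
  have key : ∀ x b : Fin 3, ∀ r < 2, (cSubSq 1 x)[r]? = some b → b ≠ 2 → r = 0 ∧ x = b := by
    decide
  exact key x b r hr h hb

variable {X : ℕ → ℕ → Fin 3}

theorem isImage_cSubSq (hX : ∀ n, IsImage (cSub (i n)) (X (n + 1)) (X n)) {n : ℕ} {j : Fin 2}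
    (h0 : i n = j) (h1 : i (n + 1) = j) : IsImage (cSubSq j) (X (n + 2)) (X n) := by
  have e0 := hX n
  have e1 := hX (n + 1)
  rw [h0] at e0
  rw [h1] at e1
  exact e1.comp e0

theorem eventually_const_of_zero (hX : ∀ n, IsImage (cSub (i n)) (X (n + 1)) (X n)) {M : ℕ}
    (hi : ∀ n, M ≤ n → i n = 0) (p : ℕ) : ∀ n, M ≤ n → X n p = 0 := by
  induction p using Nat.strong_induction_on with
  | _ p ih =>
    intro n hn
    by_contra hb
    have him := isImage_cSubSq hX (hi n hn) (hi (n + 1) (by omega))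
    obtain ⟨q, r, hp, hr⟩ := him.locate (cSubSq_ne_nil 0) p
    obtain ⟨rfl, hx⟩ := getElem?_cSubSq_zero hr hb
    have hlen := length_le_subApply (cSubSq_ne_nil 0) (win (X (n + 2)) 0 q)
    rw [win_length] at hlen
    exact hb (hx ▸ ih q (by omega) (n + 2) (by omega))

theorem eventually_const_of_one (hX : ∀ n, IsImage (cSub (i n)) (X (n + 1)) (X n)) {M : ℕ}
    (hi : ∀ n, M ≤ n → i n = 1) (d : ℕ) :
    ∀ n, M ≤ n → ∀ p, X n p ≠ 2 → X n (p + (d + 1)) = 2 := by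
  induction d using Nat.strong_induction_on with
  | _ d ih =>
    intro n hn p hp2
    by_contra hb
    have him := isImage_cSubSq hX (hi n hn) (hi (n + 1) (by omega))
    obtain ⟨q, r, hp, hr⟩ := him.locate (cSubSq_ne_nil 1) p
    obtain ⟨rfl, hx⟩ := getElem?_cSubSq_one hr hp2
    obtain ⟨q', r', hp', hr'⟩ := him.locate (cSubSq_ne_nil 1) (p + (d + 1))
    obtain ⟨rfl, hx'⟩ := getElem?_cSubSq_one hr' hb
    rcases lt_or_ge q q' with hlt | hge
    · obtain ⟨e, rfl⟩ := Nat.exists_eq_add_of_lt hlt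
      have h2 : (cSubSq 1 (X (n + 2) q)).length = 2 := by
        rw [hx]
        generalize X n p = b at hp2
        revert b
        decide
      have hlen := length_le_subApply (cSubSq_ne_nil 1) (win (X (n + 2)) (q + 1) e)
      rw [win_length] at hlen
      rw [show q + e + 1 = q + (1 + e) by omega, win_add, win_add, win_one, subApply_append,
        subApply_append, subApply_singleton, List.length_append, List.length_append, zero_add,
        h2] at hp'
      have := ih e (by omega) (n + 2) (by omega) q (by rwa [hx])
      rw [← add_assoc] at this
      exact hb (hx' ▸ this)
    · have := (win_monotone (X (n + 2)) 0 hge)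
      obtain ⟨t, ht⟩ := this
      rw [← ht, subApply_append, List.length_append] at hp
      omega

theorem not_eventually_const (hX : ∀ n, IsImage (cSub (i n)) (X (n + 1)) (X n))
    (hc : ∀ n, complexity (X 0) n = 2 * n + 1) (M J : ℕ) (z : Fin 3)
    (hJ : ∀ j, J ≤ j → X M j = z) : False := by
  obtain ⟨m, hm⟩ := exists_length_tau_le i 0 M
  have him := isImage_tau hX 0 M
  rw [zero_add] at him
  have := him.complexity_le (tau_ne_nil i 0 M) hm hJ (m * (J + 1))
  rw [hc] at this
  omega

theorem exists_ge_of_complexity (hX : ∀ n, IsImage (cSub (i n)) (X (n + 1)) (X n))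
    (hc : ∀ n, complexity (X 0) n = 2 * n + 1) (M : ℕ) (j : Fin 2) : ∃ n, M ≤ n ∧ i n = j := by
  by_contra! h
  rcases Fin.exists_fin_two.1 ⟨j, rfl⟩ with rfl | rfl
  · have hi : ∀ n, M ≤ n → i n = 1 := fun n hn => by
      have := h n hn
      omega
    by_cases hp : ∃ p, X M p ≠ 2
    · obtain ⟨p, hp⟩ := hp
      refine not_eventually_const hX hc M (p + 1) 2 fun k hk => ?_
      obtain ⟨d, rfl⟩ := Nat.exists_eq_add_of_le hk
      rw [add_assoc, add_comm 1 d]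
      exact eventually_const_of_one hX hi d M le_rfl p hp
    · push Not at hp
      exact not_eventually_const hX hc M 0 2 fun k _ => hp k
  · have hi : ∀ n, M ≤ n → i n = 0 := fun n hn => by
      have := h n hn
      omega
    exact not_eventually_const hX hc M 0 0 fun k _ => eventually_const_of_zero hX hi k M le_rfl

/-- The letters whose image under `cSub j` meets `S`. -/
def preimageLetters (j : Fin 2) (S : Finset (Fin 3)) : Finset (Fin 3) :=
  Finset.univ.filter fun a => ∃ x ∈ cSub j a, x ∈ S

theorem eventually_paired_of_ne_univ {j : ℕ → Fin 2} {S : ℕ → Finset (Fin 3)} {b : Fin 3}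
    (h0 : S 0 = {b}) (hS : ∀ t, S (t + 1) = preimageLetters (j t) (S t))
    (hne : ∀ t, S t ≠ Finset.univ) : ∃ N, ∀ k, j (N + 2 * k) = j (N + 2 * k + 1) := by
  have hstep : ∀ t, preimageLetters (j t) (S t) ≠ Finset.univ := fun t => hS t ▸ hne (t + 1)
  by_cases h01 : ∃ t, S t = {0, 1}
  · obtain ⟨N, hN⟩ := h01
    have key : ∀ j, preimageLetters j {0, 1} ≠ Finset.univ →
        j = 1 ∧ preimageLetters j {0, 1} = {0, 1} := by decide
    have hk : ∀ k, S (N + k) = {0, 1} := fun k => by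
      induction k with
      | zero => exact hN
      | succ k ih =>
        have := hstep (N + k)
        rw [ih] at this
        rw [← add_assoc, hS, ih, (key _ this).2]
    have hj : ∀ k, j (N + k) = 1 := fun k => (key _ (hk k ▸ hstep (N + k))).1
    exact ⟨N, fun k => by rw [add_assoc, hj, hj]⟩
  by_cases h12 : ∃ t, S t = {1, 2}
  · obtain ⟨N, hN⟩ := h12
    have key : ∀ j, preimageLetters j {1, 2} ≠ Finset.univ →
        j = 0 ∧ preimageLetters j {1, 2} = {1, 2} := by decide
    have hk : ∀ k, S (N + k) = {1, 2} := fun k => by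
      induction k with
      | zero => exact hN
      | succ k ih =>
        have := hstep (N + k)
        rw [ih] at this
        rw [← add_assoc, hS, ih, (key _ this).2]
    have hj : ∀ k, j (N + k) = 0 := fun k => (key _ (hk k ▸ hstep (N + k))).1
    exact ⟨N, fun k => by rw [add_assoc, hj, hj]⟩
  push Not at h01 h12
  have h01' : ∀ t, preimageLetters (j t) (S t) ≠ {0, 1} := fun t => hS t ▸ h01 (t + 1)
  have h12' : ∀ t, preimageLetters (j t) (S t) ≠ {1, 2} := fun t => hS t ▸ h12 (t + 1)
  have hN : ∃ N, S N = {1} := by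
    have key : ∀ j b, preimageLetters j {b} ≠ {0, 1} → preimageLetters j {b} ≠ {1, 2} →
        b = 1 ∨ preimageLetters j {b} = {1} := by decide
    rcases key (j 0) b (h0 ▸ h01' 0) (h0 ▸ h12' 0) with rfl | h
    · exact ⟨0, h0⟩
    · exact ⟨1, by rw [hS, h0, h]⟩
  obtain ⟨N, hN⟩ := hN
  have key : ∀ j j', preimageLetters j' (preimageLetters j {1}) ≠ {0, 1} →
      preimageLetters j' (preimageLetters j {1}) ≠ {1, 2} →
      j = j' ∧ preimageLetters j' (preimageLetters j {1}) = {1} := by decide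
  have hstep' : ∀ t, S t = {1} → j t = j (t + 1) ∧ S (t + 2) = {1} := fun t ht => by
    have h1 := h01' (t + 1)
    have h2 := h12' (t + 1)
    rw [hS t, ht] at h1 h2
    rw [hS (t + 1), hS t, ht]
    exact key _ _ h1 h2
  have hk : ∀ k, S (N + 2 * k) = {1} := fun k => by
    induction k with
    | zero => exact hN
    | succ k ih => exact (hstep' _ ih).2
  exact ⟨N, fun k => (hstep' _ (hk k)).1⟩

theorem exists_paired_of_not_mixing {n : ℕ} (h : ∀ t, ∃ a b, b ∉ tau i n t a) :
    ∃ N, ∀ k, i (N + 2 * k) = i (N + 2 * k + 1) := by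
  let S : Fin 3 → ℕ → Finset (Fin 3) := fun b t => Finset.univ.filter fun a => b ∈ tau i n t a
  have hS0 : ∀ b, S b 0 = {b} := fun b => by
    ext a
    simp [S, tau_zero, eq_comm]
  have hS : ∀ b t, S b (t + 1) = preimageLetters (i (n + t)) (S b t) := fun b t => by
    ext a
    simp [S, preimageLetters, tau_succ, mem_subApply]
  have hmono : ∀ b t s, S b t = Finset.univ → S b (t + s) = Finset.univ := fun b t s ht => by
    induction s with
    | zero => exact ht
    | succ s ih =>
      have key : ∀ j, preimageLetters j Finset.univ = Finset.univ := by decide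
      rw [← add_assoc, hS, ih, key]
  have hb : ∃ b, ∀ t, S b t ≠ Finset.univ := by
    by_contra! hb
    choose T hT using hb
    obtain ⟨a, b, hab⟩ := h (∑ b, T b)
    obtain ⟨s, hs⟩ := Nat.exists_eq_add_of_le
      (Finset.single_le_sum (f := T) (fun _ _ => Nat.zero_le _) (Finset.mem_univ b))
    have ha : a ∈ S b (∑ x, T x) := by
      rw [hs, hmono b (T b) s (hT b)]
      exact Finset.mem_univ a
    exact hab (Finset.mem_filter.1 ha).2
  obtain ⟨b, hb⟩ := hb
  obtain ⟨N, hN⟩ := eventually_paired_of_ne_univ (hS0 b) (hS b) hb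
  exact ⟨n + N, fun k => by simpa [add_assoc] using hN k⟩

theorem exists_even_of_paired {N : ℕ} (hN : ∀ k, i (N + 2 * k) = i (N + 2 * k + 1))
    (hio : ∀ M j, ∃ n, M ≤ n ∧ i n = j) (k : ℕ) (j : Fin 2) : ∃ s, i (N + 2 * (k + s)) = j := by
  obtain ⟨n, hn, rfl⟩ := hio (N + 2 * k) j
  obtain ⟨d, rfl⟩ := Nat.exists_eq_add_of_le hn
  rcases Nat.even_or_odd' d with ⟨s, rfl | rfl⟩
  · exact ⟨s, by congr 1; omega⟩
  · refine ⟨s, ?_⟩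
    rw [hN]
    congr 1
    omega

theorem ne_one_of_paired (hX : ∀ n, IsImage (cSub (i n)) (X (n + 1)) (X n)) {N : ℕ}
    (hN : ∀ k, i (N + 2 * k) = i (N + 2 * k + 1)) (hio : ∀ M j, ∃ n, M ≤ n ∧ i n = j)
    (p : ℕ) : ∀ k, X (N + 2 * k) p ≠ 1 := by
  have him : ∀ k, IsImage (cSubSq (i (N + 2 * k))) (X (N + 2 * (k + 1))) (X (N + 2 * k)) :=
    fun k => isImage_cSubSq hX rfl (hN k).symm
  have hstep : ∀ k p, X (N + 2 * k) p = 1 → ∃ q ≤ p, X (N + 2 * (k + 1)) q = 1 ∧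
      (i (N + 2 * k) = 0 → q < p) := by
    intro k p hp
    have hk := him k
    obtain ⟨q, r, hpq, hr⟩ := hk.locate (cSubSq_ne_nil _) p
    have hlen := length_le_subApply (cSubSq_ne_nil (i (N + 2 * k))) (win (X (N + 2 * (k + 1))) 0 q)
    rw [win_length] at hlen
    refine ⟨q, by omega, ?_⟩
    rcases Fin.exists_fin_two.1 ⟨i (N + 2 * k), rfl⟩ with h | h
    · rw [h] at hr
      obtain ⟨rfl, hx⟩ := getElem?_cSubSq_zero hr (by rw [hp]; decide)
      exact ⟨hx.trans hp, fun _ => by omega⟩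
    · rw [h] at hr
      obtain ⟨rfl, hx⟩ := getElem?_cSubSq_one hr (by rw [hp]; decide)
      exact ⟨hx.trans hp, fun h' => by simp [h] at h'⟩
  induction p using Nat.strong_induction_on with
  | _ p ih =>
    intro k hp
    obtain ⟨s, hs⟩ := exists_even_of_paired hN hio k 0
    have hq : ∀ s, ∃ q ≤ p, X (N + 2 * (k + s)) q = 1 := fun s => by
      induction s with
      | zero => exact ⟨p, le_rfl, hp⟩
      | succ s ih =>
        obtain ⟨q, hq, h⟩ := ih
        obtain ⟨q', hq', h', -⟩ := hstep _ _ h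
        exact ⟨q', hq'.trans hq, h'⟩
    obtain ⟨q, hqp, hq⟩ := hq s
    obtain ⟨q', hq', h1, h2⟩ := hstep _ _ hq
    exact ih q' (lt_of_lt_of_le (h2 hs) hqp) (k + s + 1) h1

theorem exists_tau_of_paired {N : ℕ} (hN : ∀ k, i (N + 2 * k) = i (N + 2 * k + 1))
    (hio : ∀ M j, ∃ n, M ≤ n ∧ i n = j) (k : ℕ) :
    ∃ t, ∀ a b : Fin 3, a ≠ 1 → b ≠ 1 → b ∈ tau i (N + 2 * k) (2 * t) a := by
  have hsucc : ∀ s a, tau i (N + 2 * k) (2 * (s + 1)) a =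
      subApply (tau i (N + 2 * k) (2 * s)) (cSubSq (i (N + 2 * (k + s))) a) := by
    intro s a
    have h := hN (k + s)
    rw [mul_add, ← add_assoc] at h
    rw [show 2 * (s + 1) = 2 * s + 1 + 1 by ring, tau_succ, mul_add, ← add_assoc, cSubSq]
    rw [← add_assoc, ← h]
    change subApply (fun a => subApply _ (cSub _ a)) _ = _
    rw [subApply_subApply]
    rfl
  have hself : ∀ j a, a ≠ 1 → a ∈ cSubSq j a := by decide
  have hmono : ∀ s d a b, a ≠ 1 → b ∈ tau i (N + 2 * k) (2 * s) a →
      b ∈ tau i (N + 2 * k) (2 * (s + d)) a := by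
    intro s d a b ha hb
    induction d with
    | zero => exact hb
    | succ d ih =>
      rw [← add_assoc, hsucc]
      exact mem_subApply.2 ⟨a, hself _ a ha, ih⟩
  have hrefl : ∀ s a, a ≠ 1 → a ∈ tau i (N + 2 * k) (2 * s) a := fun s a ha => by
    have := hmono 0 s a a ha (by simp [tau_zero])
    rwa [zero_add] at this
  obtain ⟨s, hs⟩ := exists_even_of_paired hN hio k 0
  obtain ⟨s', hs'⟩ := exists_even_of_paired hN hio k 1
  have h2 : 0 ∈ tau i (N + 2 * k) (2 * (s + 1)) 2 := by
    rw [hsucc, hs]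
    exact mem_subApply.2 ⟨0, by decide, hrefl s 0 (by decide)⟩
  have h0 : 2 ∈ tau i (N + 2 * k) (2 * (s' + 1)) 0 := by
    rw [hsucc, hs']
    exact mem_subApply.2 ⟨2, by decide, hrefl s' 2 (by decide)⟩
  refine ⟨s + 1 + (s' + 1), fun a b ha hb => ?_⟩
  fin_cases a <;> fin_cases b
  · exact hrefl _ 0 (by decide)
  · exact absurd rfl hb
  · rw [add_comm (s + 1)]
    exact hmono _ _ 0 2 (by decide) h0
  · exact absurd rfl ha
  · exact absurd rfl ha
  · exact absurd rfl ha
  · exact hmono _ _ 2 0 (by decide) h2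
  · exact absurd rfl hb
  · exact hrefl _ 2 (by decide)

theorem isMixing_of_paired (hX : ∀ n, IsImage (cSub (i n)) (X (n + 1)) (X n)) {N : ℕ}
    (hN : ∀ k, i (N + 2 * k) = i (N + 2 * k + 1)) (hio : ∀ M j, ∃ n, M ≤ n ∧ i n = j) :
    IsMixing i X := by
  intro n
  obtain ⟨s, hs⟩ := Nat.exists_eq_add_of_le (show n ≤ N + 2 * n by omega)
  obtain ⟨t, ht⟩ := exists_tau_of_paired hN hio n
  have hletter : ∀ k a, [a] ∈ fac (X (N + 2 * k)) → a ≠ 1 := by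
    rintro k a ha rfl
    obtain ⟨p, hp⟩ := singleton_mem_fac.1 ha
    exact ne_one_of_paired hX hN hio p k hp
  refine ⟨s + 2 * t, fun a ha => ?_⟩
  rw [← add_assoc, ← hs, add_assoc, ← mul_add] at ha
  rw [tau_add, ← hs]
  have ha1 := hletter _ a ha
  constructor
  · have hsp : ([0, 2] : List (Fin 3)).Subperm (tau i (N + 2 * n) (2 * t) a) :=
      List.subperm_of_subset (by decide) fun b hb => ht a b ha1 (by
        revert b
        decide)
    have h1 := hsp.length_le
    exact le_trans h1 (length_le_subApply (tau_ne_nil i n s) _)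
  · intro b hb
    obtain ⟨p, hp⟩ := singleton_mem_fac.1 hb
    have him := isImage_tau hX n s
    rw [← hs] at him
    obtain ⟨q, r, -, hr⟩ := him.locate (tau_ne_nil i n s) p
    rw [hp] at hr
    exact mem_subApply.2 ⟨_, ht a _ ha1 (ne_one_of_paired hX hN hio q n),
      List.mem_of_getElem? hr⟩

theorem not_paired_of_complexity (hX : ∀ n, IsImage (cSub (i n)) (X (n + 1)) (X n))
    (hc : ∀ n, complexity (X 0) n = 2 * n + 1) {N : ℕ}
    (hN : ∀ k, i (N + 2 * k) = i (N + 2 * k + 1)) : False := by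
  have hio := exists_ge_of_complexity hX hc
  have hchain := (isMixing_of_paired hX hN hio).langChain hX
  have hne := ne_one_of_paired hX hN hio
  have d0 : Defective (fac (X N)) := Or.inl ⟨1, fun h => by
    obtain ⟨p, hp⟩ := singleton_mem_fac.1 h
    exact hne p 0 hp⟩
  have d1 : Defective (fac (X (N + 1))) := by
    have key : ∀ j : Fin 2, ∃ a, ∀ x : Fin 3, x ≠ 1 → a ∉ cSub j x := by decide
    obtain ⟨a, ha⟩ := key (i (N + 1))
    refine Or.inl ⟨a, fun h => ?_⟩
    rw [hchain.image (N + 1), singleton_mem_imageLang (hchain.biext _)] at h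
    obtain ⟨x, hx, hax⟩ := h
    obtain ⟨p, rfl⟩ := singleton_mem_fac.1 hx
    exact ha _ (hne p 1) hax
  refine not_defective_of_card_words (hchain.biext 0) (fun u hu => hchain.good 0 hu) (fun n => ?_)
    (hchain.defective d0 d1)
  rw [← complexity_eq, hc]

end DirectiveSequence

theorem complexity_eq_iff_primitive (i : ℕ → Fin 2) (w : ℕ → Fin 3)
    (hw : ∃ a : ℕ → Fin 3, LimitWord (fun n => cSub (i n)) a w) :
    (∀ n : ℕ, complexity w n = 2 * n + 1) ↔ IsPrimitiveSeq (fun n => cMat (i n)) := by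
  obtain ⟨a, hw⟩ := hw
  obtain ⟨X, rfl, hX⟩ := exists_desubstitution hw
  rw [isPrimitiveSeq_iff]
  refine ⟨fun hc => ?_, complexity_of_primitive hX⟩
  by_contra! h
  obtain ⟨n, hn⟩ := h
  obtain ⟨N, hN⟩ := exists_paired_of_not_mixing hn
  exact not_paired_of_complexity hX hc hN
end
end

section
/- Let (σ_n) ∈ {c1,c2}^ℕ be a sequence of substitutions containing infinitely many occurrences of c1 and infinitely many occurrences of c2. Then for every sequence of letters (a_n) ∈ {1,2,3}^ℕ, the sequence of words σ_{[0,n)}(a_n) converges to an infinite word w ∈ {1,2,3}^ℕ which does not depend on the choice of (a_n); in particular w = lim_{n→∞} σ_{[0,n)}(1). Precisely: there is a unique w ∈ {1,2,3}^ℕ such that for every k ∈ ℕ there is N with the property that for all n ≥ N the word σ_{[0,n)}(a_n) has length ≥ k and its first k letters agree with those of w. -/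
open Matrix Filter MeasureTheory

noncomputable section

/-- The first letter of the image of a letter under `cSub e`. -/
def firstLetter : Fin 2 → Fin 3 → Fin 3 := ![![0, 0, 1], ![1, 0, 2]]

theorem dirProd_firstLetter_isPrefix (i : ℕ → Fin 2) (n : ℕ) (a : Fin 3) :
    dirProd (fun n => cSub (i n)) n (firstLetter (i n) a) <+:
      dirProd (fun n => cSub (i n)) (n + 1) a := by
  obtain h | h : i n = 0 ∨ i n = 1 := by omega
  all_goals fin_cases a <;>
    simp [dirProd, subApply, firstLetter, cSub, c1, c2, h]

theorem length_dirProd_succ_of_eq_zero {i : ℕ → Fin 2} {n : ℕ} (h : i n = 0) (a : Fin 3) :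
    (dirProd (fun n => cSub (i n)) (n + 1) a).length =
      ![(dirProd (fun n => cSub (i n)) n 0).length,
        (dirProd (fun n => cSub (i n)) n 0).length + (dirProd (fun n => cSub (i n)) n 2).length,
        (dirProd (fun n => cSub (i n)) n 1).length] a := by
  fin_cases a <;> simp [dirProd, subApply, cSub, c1, h]

theorem length_dirProd_succ_of_eq_one {i : ℕ → Fin 2} {n : ℕ} (h : i n = 1) (a : Fin 3) :
    (dirProd (fun n => cSub (i n)) (n + 1) a).length =
      ![(dirProd (fun n => cSub (i n)) n 1).length,
        (dirProd (fun n => cSub (i n)) n 0).length + (dirProd (fun n => cSub (i n)) n 2).length,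
        (dirProd (fun n => cSub (i n)) n 2).length] a := by
  fin_cases a <;> simp [dirProd, subApply, cSub, c2, h]

theorem length_dirProd_bounds (i : ℕ → Fin 2) (n : ℕ) :
    let L := fun a => (dirProd (fun n => cSub (i n)) n a).length
    1 ≤ L 0 ∧ L 0 ≤ L 1 ∧ L 2 ≤ L 1 ∧ L 1 ≤ L 0 + L 2 := by
  induction n with
  | zero => simp [dirProd]
  | succ n ih =>
    obtain h | h : i n = 0 ∨ i n = 1 := by omega
    · simp [length_dirProd_succ_of_eq_zero h] at ih ⊢
      omega
    · simp [length_dirProd_succ_of_eq_one h] at ih ⊢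
      omega

theorem monotone_length_dirProd (i : ℕ → Fin 2) (a : Fin 3) :
    Monotone fun n => (dirProd (fun n => cSub (i n)) n a).length := by
  refine monotone_nat_of_le_succ fun n => ?_
  have hb := length_dirProd_bounds i n
  obtain h | h : i n = 0 ∨ i n = 1 := by omega
  · fin_cases a <;> simp [length_dirProd_succ_of_eq_zero h] at hb ⊢ <;> omega
  · fin_cases a <;> simp [length_dirProd_succ_of_eq_one h] at hb ⊢ <;> omega

theorem exists_le_length_dirProd_one {i : ℕ → Fin 2} (h1 : ∀ N : ℕ, ∃ n ≥ N, i n = 0) (k : ℕ) :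
    ∃ m, k ≤ (dirProd (fun n => cSub (i n)) m 1).length := by
  induction k with
  | zero => exact ⟨0, Nat.zero_le _⟩
  | succ k ih =>
    obtain ⟨m, hm⟩ := ih
    obtain ⟨p, hp, hip⟩ := h1 m
    obtain ⟨q, hq, hiq⟩ := h1 (p + 1)
    refine ⟨q + 1, ?_⟩
    have hmp := monotone_length_dirProd i 1 hp
    have hpq := monotone_length_dirProd i 2 hq
    have hb := length_dirProd_bounds i q
    simp [length_dirProd_succ_of_eq_zero hip, length_dirProd_succ_of_eq_zero hiq]
      at hmp hpq hb ⊢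
    omega

theorem exists_forall_le_length_dirProd {i : ℕ → Fin 2} (h1 : ∀ N : ℕ, ∃ n ≥ N, i n = 0)
    (h2 : ∀ N : ℕ, ∃ n ≥ N, i n = 1) (k : ℕ) :
    ∃ m, ∀ a, k ≤ (dirProd (fun n => cSub (i n)) m a).length := by
  obtain ⟨m, hm⟩ := exists_le_length_dirProd_one h1 k
  obtain ⟨p, hp, hip⟩ := h1 m
  obtain ⟨q, hq, hiq⟩ := h2 m
  have key : ∀ a r, r ≤ max p q + 1 → k ≤ (dirProd (fun n => cSub (i n)) r a).length →
      k ≤ (dirProd (fun n => cSub (i n)) (max p q + 1) a).length :=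
    fun a r hr h => h.trans (monotone_length_dirProd i a hr)
  refine ⟨max p q + 1, fun a => ?_⟩
  fin_cases a
  · refine key 0 (q + 1) (by omega) ?_
    simpa [length_dirProd_succ_of_eq_one hiq] using hm.trans (monotone_length_dirProd i 1 hq)
  · exact key 1 m (by omega) hm
  · refine key 2 (p + 1) (by omega) ?_
    simpa [length_dirProd_succ_of_eq_zero hip] using hm.trans (monotone_length_dirProd i 1 hp)

/-- If a property of maps `Fin 3 → Fin 3` is stable under precomposition with `firstLetter e`,
then it propagates along the maps recording which level-`m` word starts a level-`n` word. -/
theorem exists_isPrefix_of_le {i : ℕ → Fin 2} {P : (Fin 3 → Fin 3) → Prop}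
    (hP : ∀ e g, P g → P (g ∘ firstLetter e)) {m p : ℕ}
    (hp : ∃ g, P g ∧ ∀ a,
      dirProd (fun n => cSub (i n)) m (g a) <+: dirProd (fun n => cSub (i n)) p a)
    {n : ℕ} (hn : p ≤ n) :
    ∃ g, P g ∧ ∀ a,
      dirProd (fun n => cSub (i n)) m (g a) <+: dirProd (fun n => cSub (i n)) n a := by
  induction n, hn using Nat.le_induction with
  | base => exact hp
  | succ n _ ih =>
    obtain ⟨g, hg, hpre⟩ := ih
    exact ⟨g ∘ firstLetter (i n), hP _ _ hg,
      fun a => (hpre _).trans (dirProd_firstLetter_isPrefix i n a)⟩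

theorem exists_forall_isPrefix {i : ℕ → Fin 2} (h1 : ∀ N : ℕ, ∃ n ≥ N, i n = 0) (m : ℕ) :
    ∃ b N, ∀ n ≥ N, ∀ a,
      dirProd (fun n => cSub (i n)) m b <+: dirProd (fun n => cSub (i n)) n a := by
  obtain ⟨p, hp, hip⟩ := h1 m
  obtain ⟨q, hq, hiq⟩ := h1 (p + 1)
  obtain ⟨g, -, hg⟩ := exists_isPrefix_of_le (i := i) (P := fun _ => True)
    (fun _ _ _ => trivial) ⟨id, trivial, fun a => List.prefix_rfl⟩ hp
  obtain ⟨g', hg01, hg'⟩ := exists_isPrefix_of_le (i := i) (m := m) (P := fun g => g 0 = g 1)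
    (fun e g h => by fin_cases e <;> simp [firstLetter, h])
    ⟨g ∘ firstLetter (i p), by simp [hip, firstLetter],
      fun a => (hg _).trans (dirProd_firstLetter_isPrefix i p a)⟩ hq
  refine ⟨g' 0, q + 1, fun n hn a => ?_⟩
  obtain ⟨c, hc, hpre⟩ := exists_isPrefix_of_le (i := i) (m := m) (P := fun g => ∀ a, g a = g' 0)
    (fun e g h a => h _)
    ⟨g' ∘ firstLetter (i q),
      fun a => by fin_cases a <;> simp [hiq, firstLetter, hg01],
      fun a => (hg' _).trans (dirProd_firstLetter_isPrefix i q a)⟩ hn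
  exact hc a ▸ hpre a

theorem exists_common_initial_word {i : ℕ → Fin 2} (h1 : ∀ N : ℕ, ∃ n ≥ N, i n = 0)
    (h2 : ∀ N : ℕ, ∃ n ≥ N, i n = 1) (k : ℕ) :
    ∃ (u : List (Fin 3)) (N : ℕ), k ≤ u.length ∧
      ∀ n ≥ N, ∀ a, u <+: dirProd (fun n => cSub (i n)) n a := by
  obtain ⟨m, hm⟩ := exists_forall_le_length_dirProd h1 h2 k
  obtain ⟨b, N, hN⟩ := exists_forall_isPrefix h1 m
  exact ⟨_, N, hm b, hN⟩

theorem limit_exists_and_unique (i : ℕ → Fin 2)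
    (h1 : ∀ N : ℕ, ∃ n ≥ N, i n = 0) (h2 : ∀ N : ℕ, ∃ n ≥ N, i n = 1) :
    ∃! w : ℕ → Fin 3, ∀ a : ℕ → Fin 3, LimitWord (fun n => cSub (i n)) a w := by
  choose u N hlen hpre using exists_common_initial_word h1 h2
  have hget : ∀ k n a j, N k ≤ n → j < k →
      (dirProd (fun n => cSub (i n)) n a)[j]? = (u k)[j]? := fun k n a j hn hj => by
    have hj' := hj.trans_le (hlen k)
    rw [List.getElem?_eq_getElem hj']
    exact List.prefix_iff_getElem?.mp (hpre k n hn a) j hj'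
  refine ⟨fun j => (u (j + 1))[j]'(hlen (j + 1)), fun a k => ⟨N k, fun n hn => ⟨?_, ?_⟩⟩, ?_⟩
  · exact (hlen k).trans (hpre k n hn (a n)).length_le
  · intro j hj
    rw [hget k n _ j hn hj, ← hget k (max (N k) (N (j + 1))) 0 j (le_max_left _ _) hj,
      hget (j + 1) _ 0 j (le_max_right _ _) j.lt_succ_self, List.getElem?_eq_getElem]
  · intro w hw
    ext1 j
    obtain ⟨M, hM⟩ := hw (fun _ => 0) (j + 1)
    have hwj := (hM (max M (N (j + 1))) (le_max_left _ _)).2 j j.lt_succ_self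
    rw [hget (j + 1) _ 0 j (le_max_right _ _) j.lt_succ_self,
      List.getElem?_eq_getElem (hlen (j + 1))] at hwj
    exact (Option.some.inj hwj).symm
end
end
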